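/- arXiv:1601.00530 — 4 statements merged into one kernel-verified Lean document; each statement's English description precedes it below -/
import Mathlib

section
/- Let N be a positive integer, let x ∈ ℝ^N satisfy ‖x‖₂ = 1, let φ be a standard Gaussian random vector on ℝ^N, and let b be a random sign independent of φ with P(b = −1) = ρ and P(b = 1) = 1 − ρ, where 0 ≤ ρ < 1/2. Set y = b·sign(xᵀφ). Then for every index j ∈ {1,…,N}, the probability that y ≠ sign(φ_j) — equivalently, the probability of the event {b·(xᵀφ)·φ_j < 0}, which agrees with it almost surely — equals ((1 − 2ρ)/π)·arccos(x_j) + ρ. -/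
open MeasureTheory ProbabilityTheory

/-- The two-point measure on `ℝ` (supported on `{-1, 1}`) assigning mass `ρ`
to `-1` and `1 - ρ` to `1`: the law of the random sign flip `b`. -/
noncomputable def signFlipMeasure (ρ : ℝ) : Measure ℝ :=
  ENNReal.ofReal ρ • Measure.dirac (-1) + ENNReal.ofReal (1 - ρ) • Measure.dirac 1

open Set

/-- The characteristic function of a pair of linear functionals of a standard Gaussian vector. -/
lemma charFunDual_map_pair_linear_gaussian {ι : Type*} [Fintype ι] (x y : ι → ℝ)
    (L : StrongDual ℝ (ℝ × ℝ)) :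
    charFunDual ((Measure.pi fun _ : ι => gaussianReal 0 1).map
        (fun φ => (∑ i, x i * φ i, ∑ i, y i * φ i))) L =
      Complex.exp (-((L (1, 0) ^ 2 * ∑ i, x i ^ 2 + 2 * L (1, 0) * L (0, 1) * ∑ i, x i * y i +
        L (0, 1) ^ 2 * ∑ i, y i ^ 2 : ℝ) : ℂ) / 2) := by
  rw [charFunDual_apply, integral_map (Measurable.aemeasurable (by fun_prop))
    (Measurable.aestronglyMeasurable (by fun_prop))]
  have expand (φ : ι → ℝ) : Complex.exp (L (∑ i, x i * φ i, ∑ i, y i * φ i) * Complex.I) =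
      ∏ i, Complex.exp ((L (1, 0) * x i + L (0, 1) * y i : ℝ) * φ i * Complex.I) := by
    have hL (s t : ℝ) : L (s, t) = s * L (1, 0) + t * L (0, 1) := by
      rw [← smul_eq_mul, ← smul_eq_mul, ← map_smul, ← map_smul, ← map_add]
      simp
    rw [← Complex.exp_sum, hL, ← Finset.sum_mul]
    congr 2
    push_cast
    rw [Finset.sum_mul, Finset.sum_mul, ← Finset.sum_add_distrib]
    exact Finset.sum_congr rfl fun i _ => by ring
  simp_rw [expand]
  rw [integral_fintype_prod_eq_prod
    (fun i (t : ℝ) => Complex.exp ((L (1, 0) * x i + L (0, 1) * y i : ℝ) * t * Complex.I))]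
  simp_rw [← charFun_apply_real, charFun_gaussianReal]
  rw [← Complex.exp_sum]
  congr 1
  push_cast
  simp only [Finset.mul_sum, ← Finset.sum_add_distrib, neg_div, Finset.sum_div,
    ← Finset.sum_neg_distrib]
  exact Finset.sum_congr rfl fun i _ => by simp; ring

/-- The joint law of two linear functionals of a standard Gaussian vector is determined by the
inner products of their coefficient vectors. -/
lemma map_pair_linear_gaussian_eq {ι κ : Type*} [Fintype ι] [Fintype κ]
    {x y : ι → ℝ} {u v : κ → ℝ} (hx : ∑ i, x i ^ 2 = ∑ k, u k ^ 2)
    (hxy : ∑ i, x i * y i = ∑ k, u k * v k) (hy : ∑ i, y i ^ 2 = ∑ k, v k ^ 2) :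
    (Measure.pi fun _ : ι => gaussianReal 0 1).map
        (fun φ => (∑ i, x i * φ i, ∑ i, y i * φ i)) =
      (Measure.pi fun _ : κ => gaussianReal 0 1).map
        (fun φ => (∑ k, u k * φ k, ∑ k, v k * φ k)) := by
  refine Measure.ext_of_charFunDual (funext fun L => ?_)
  simp only [charFunDual_map_pair_linear_gaussian, hx, hxy, hy]

/-- The mass that the standard Gaussian measure on the plane gives to a cone is proportional to
its angular measure. -/
lemma gaussian_prod_apply_cone {s : Set (ℝ × ℝ)} (hs : MeasurableSet s)
    (hcone : ∀ r : ℝ, 0 < r → ∀ p : ℝ × ℝ, r • p ∈ s ↔ p ∈ s) :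
    ((gaussianReal 0 1).prod (gaussianReal 0 1)) s =
      volume {α ∈ Ioo (-Real.pi) Real.pi | (Real.cos α, Real.sin α) ∈ s} /
        ENNReal.ofReal (2 * Real.pi) := by
  obtain ⟨K, hK⟩ : ∃ K : ENNReal, ∀ t : Set (ℝ × ℝ), MeasurableSet t →
      (∀ r : ℝ, 0 < r → ∀ p : ℝ × ℝ, r • p ∈ t ↔ p ∈ t) →
      ((gaussianReal 0 1).prod (gaussianReal 0 1)) t =
        K * volume {α ∈ Ioo (-Real.pi) Real.pi | (Real.cos α, Real.sin α) ∈ t} := by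
    refine ⟨∫⁻ r in Ioi (0 : ℝ), ENNReal.ofReal r *
      ENNReal.ofReal ((√(2 * Real.pi))⁻¹ ^ 2 * Real.exp (-r ^ 2 / 2)), fun t ht htcone => ?_⟩
    have angle_meas : MeasurableSet {α : ℝ | (Real.cos α, Real.sin α) ∈ t} :=
      (Real.measurable_cos.prodMk Real.measurable_sin) ht
    rw [gaussianReal_of_var_ne_zero _ one_ne_zero,
      prod_withDensity (measurable_gaussianPDF 0 1) (measurable_gaussianPDF 0 1),
      withDensity_apply _ ht, ← lintegral_indicator ht, ← Measure.volume_eq_prod,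
      ← lintegral_comp_polarCoord_symm]
    have factor : ∀ p ∈ polarCoord.target,
        ENNReal.ofReal p.1 • t.indicator (fun z => gaussianPDF 0 1 z.1 * gaussianPDF 0 1 z.2)
          (polarCoord.symm p) =
        ENNReal.ofReal p.1 *
          ENNReal.ofReal ((√(2 * Real.pi))⁻¹ ^ 2 * Real.exp (-p.1 ^ 2 / 2)) *
          {α : ℝ | (Real.cos α, Real.sin α) ∈ t}.indicator 1 p.2 := by
      rintro ⟨r, α⟩ hp
      have hr : 0 < r := hp.1
      have hmem : polarCoord.symm (r, α) ∈ t ↔ (Real.cos α, Real.sin α) ∈ t := by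
        rw [← htcone r hr (Real.cos α, Real.sin α)]
        simp
      by_cases h : (Real.cos α, Real.sin α) ∈ t
      · rw [indicator_of_mem (hmem.2 h), indicator_of_mem (by exact h), smul_eq_mul,
          Pi.one_apply, mul_one, gaussianPDF, gaussianPDF,
          ← ENNReal.ofReal_mul (gaussianPDFReal_nonneg _ _ _)]
        congr 2
        simp only [gaussianPDFReal_def, polarCoord_symm_apply]
        rw [mul_mul_mul_comm, ← Real.exp_add, ← sq]
        simp only [NNReal.coe_one, mul_one]
        congr 2
        linear_combination (-r ^ 2 / 2) * Real.cos_sq_add_sin_sq α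
      · rw [indicator_of_notMem (mt hmem.1 h), indicator_of_notMem (by exact h)]
        simp
    rw [setLIntegral_congr_fun polarCoord.open_target.measurableSet factor, polarCoord_target,
      Measure.volume_eq_prod, ← Measure.prod_restrict, lintegral_prod_mul
        (f := fun r => ENNReal.ofReal r *
          ENNReal.ofReal ((√(2 * Real.pi))⁻¹ ^ 2 * Real.exp (-r ^ 2 / 2)))
        (g := {α : ℝ | (Real.cos α, Real.sin α) ∈ t}.indicator 1) (by fun_prop)
        (measurable_one.indicator angle_meas).aemeasurable, lintegral_indicator_one angle_meas,
      Measure.restrict_apply angle_meas, inter_comm]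
    rfl
  have total := hK univ .univ (by simp)
  simp only [measure_univ, mem_univ, and_true, ofPred_mem_eq, Real.volume_Ioo] at total
  rw [hK s hs hcone, mul_comm, ENNReal.div_eq_inv_mul, mul_comm]
  congr 1
  exact ENNReal.eq_inv_of_mul_eq_one_left (by rw [total]; ring_nf)

/-- The set of angles `α` for which `sin (θ + α)` and `sin α` have opposite signs has
measure `2 * θ`. -/
lemma volume_sin_add_mul_sin_neg {θ : ℝ} (h0 : 0 ≤ θ) (hπ : θ ≤ Real.pi) :
    volume {α ∈ Ioo (-Real.pi) Real.pi |
      (Real.sin θ * Real.cos α + Real.cos θ * Real.sin α) * Real.sin α < 0} =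
      ENNReal.ofReal (2 * θ) := by
  have arcs : {α ∈ Ioo (-Real.pi) Real.pi |
      (Real.sin θ * Real.cos α + Real.cos θ * Real.sin α) * Real.sin α < 0} =
      Ioo (-θ) 0 ∪ Ioo (Real.pi - θ) Real.pi := by
    ext α
    simp only [mem_ofPred_eq, mem_union, mem_Ioo, ← Real.sin_add]
    constructor
    · rintro ⟨⟨h1, h2⟩, h⟩
      rcases mul_neg_iff.1 h with ⟨ha, hb⟩ | ⟨ha, hb⟩
      · left
        refine ⟨?_, ?_⟩
        · by_contra! hc
          linarith [Real.sin_nonpos_of_nonpos_of_neg_pi_le (x := θ + α) (by linarith) (by linarith)]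
        · by_contra! hc
          linarith [Real.sin_nonneg_of_nonneg_of_le_pi hc h2.le]
      · right
        refine ⟨?_, h2⟩
        have hα : 0 < α := by
          by_contra! hc
          linarith [Real.sin_nonpos_of_nonpos_of_neg_pi_le hc h1.le]
        by_contra! hc
        linarith [Real.sin_nonneg_of_nonneg_of_le_pi (x := θ + α) (by linarith) (by linarith)]
    · rintro (⟨h1, h2⟩ | ⟨h1, h2⟩)
      · exact ⟨⟨by linarith, by linarith [Real.pi_pos]⟩, mul_neg_of_pos_of_neg
          (Real.sin_pos_of_pos_of_lt_pi (by linarith) (by linarith))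
          (Real.sin_neg_of_neg_of_neg_pi_lt h2 (by linarith))⟩
      · refine ⟨⟨by linarith, h2⟩, mul_neg_of_neg_of_pos ?_
          (Real.sin_pos_of_pos_of_lt_pi (by linarith) h2)⟩
        have : Real.sin (θ + α) = -Real.sin (θ + α - Real.pi) := by simp [Real.sin_sub_pi]
        rw [this, neg_lt_zero]
        exact Real.sin_pos_of_pos_of_lt_pi (by linarith) (by linarith)
  have disj : Disjoint (Ioo (-θ) 0) (Ioo (Real.pi - θ) Real.pi) :=
    disjoint_left.2 fun α h1 h2 => by linarith [h1.2, h2.1]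
  rw [arcs, measure_union disj measurableSet_Ioo, Real.volume_Ioo, Real.volume_Ioo,
    ← ENNReal.ofReal_add (by linarith) (by linarith)]
  ring_nf

/-- The probability that a linear functional with unit coefficient vector and a coordinate of a
standard Gaussian vector have opposite signs. -/
lemma gaussian_linear_mul_coord_neg {ι : Type*} [Fintype ι] (x : ι → ℝ)
    (hx : ∑ i, x i ^ 2 = 1) (j : ι) :
    (Measure.pi fun _ : ι => gaussianReal 0 1) {φ | (∑ i, x i * φ i) * φ j < 0} =
      ENNReal.ofReal (Real.arccos (x j) / Real.pi) := by
  classical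
  have hxj : |x j| ≤ 1 := by
    rw [← sq_le_one_iff_abs_le_one, ← hx]
    exact Finset.single_le_sum (f := fun i => x i ^ 2) (fun i _ => sq_nonneg _) (Finset.mem_univ j)
  have hcos : Real.cos (Real.arccos (x j)) = x j :=
    Real.cos_arccos (neg_le_of_abs_le hxj) (le_of_abs_le hxj)
  set θ := Real.arccos (x j)
  have law := map_pair_linear_gaussian_eq (x := x) (y := Pi.single j 1)
    (u := ![Real.sin θ, Real.cos θ]) (v := ![0, 1])
    (by simp [hx]) (by simp [Pi.single_apply, hcos]) (by simp [Pi.single_apply])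
  have hneg : MeasurableSet {p : ℝ × ℝ | p.1 * p.2 < 0} :=
    measurableSet_lt (by fun_prop) measurable_const
  have hrot : MeasurableSet
      {p : ℝ × ℝ | (Real.sin θ * p.1 + Real.cos θ * p.2) * p.2 < 0} :=
    measurableSet_lt (by fun_prop) measurable_const
  have key := congrArg (fun m => m {p : ℝ × ℝ | p.1 * p.2 < 0}) law
  rw [Measure.map_apply (by fun_prop) hneg, Measure.map_apply (by fun_prop) hneg] at key
  simp only [preimage_ofPred_eq, Pi.single_apply, ite_mul, one_mul, zero_mul,
    Finset.sum_ite_eq', Finset.mem_univ, if_true, Fin.sum_univ_two, Matrix.cons_val_zero,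
    Matrix.cons_val_one, zero_add] at key
  have planar := (measurePreserving_finTwoArrow (gaussianReal 0 1)).measure_preimage
    hrot.nullMeasurableSet
  rw [key]
  refine planar.trans ?_
  rw [gaussian_prod_apply_cone hrot]
  · simp only [mem_ofPred_eq]
    rw [volume_sin_add_mul_sin_neg (Real.arccos_nonneg _) (Real.arccos_le_pi _),
      ← ENNReal.ofReal_div_of_pos (by positivity), mul_div_mul_left _ _ two_ne_zero]
  · intro r hr p
    simp only [mem_ofPred_eq, Prod.smul_fst, Prod.smul_snd, smul_eq_mul]
    rw [show (Real.sin θ * (r * p.1) + Real.cos θ * (r * p.2)) * (r * p.2) =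
      r ^ 2 * ((Real.sin θ * p.1 + Real.cos θ * p.2) * p.2) by ring]
    simp [mul_neg_iff, pow_pos hr 2, (pow_pos hr 2).not_gt]

/-- **Lemma 1 (sign-flip version of the APP).**
If `x ∈ ℝ^N` has unit norm, `φ` is a standard Gaussian random vector on `ℝ^N`,
and `b` is an independent random sign with `ℙ(b = -1) = ρ`, `0 ≤ ρ < 1/2`
(their joint law being the product measure), then for `y = b·sign(xᵀφ)` and any
coordinate `j`,
`ℙ(y ≠ sign(φ_j)) = ℙ(b·(xᵀφ)·φ_j < 0) = ((1-2ρ)/π)·arccos(x_j) + ρ`. -/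
theorem sign_flip_probability
    (N : ℕ) (hN : 0 < N) (x : Fin N → ℝ) (hx : ∑ i, x i ^ 2 = 1)
    (ρ : ℝ) (hρ0 : 0 ≤ ρ) (hρ : ρ < 1 / 2) (j : Fin N) :
    ((signFlipMeasure ρ).prod (Measure.pi fun _ : Fin N => gaussianReal 0 1))
        {p : ℝ × (Fin N → ℝ) | p.1 * (∑ i, x i * p.2 i) * p.2 j < 0} =
      ENNReal.ofReal ((1 - 2 * ρ) / Real.pi * Real.arccos (x j) + ρ) := by
  have hmeas : MeasurableSet
      {p : ℝ × (Fin N → ℝ) | p.1 * (∑ i, x i * p.2 i) * p.2 j < 0} :=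
    measurableSet_lt (by fun_prop) measurable_const
  have unflipped := gaussian_linear_mul_coord_neg x hx j
  have flipped := gaussian_linear_mul_coord_neg (fun i => -x i) (by simpa using hx) j
  simp only [neg_mul, Finset.sum_neg_distrib, Real.arccos_neg] at flipped
  rw [Measure.prod_apply hmeas, signFlipMeasure, lintegral_add_measure, lintegral_smul_measure,
    lintegral_smul_measure, lintegral_dirac, lintegral_dirac]
  simp only [preimage_ofPred_eq, neg_mul, one_mul, smul_eq_mul]
  have hθ := div_nonneg (Real.arccos_nonneg (x j)) Real.pi_pos.le
  have hθ' := div_nonneg (sub_nonneg.2 (Real.arccos_le_pi (x j))) Real.pi_pos.le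
  rw [flipped, unflipped, ← ENNReal.ofReal_mul hρ0, ← ENNReal.ofReal_mul (by linarith),
    ← ENNReal.ofReal_add (mul_nonneg hρ0 hθ') (mul_nonneg (by linarith) hθ)]
  congr 1
  field_simp
  ring
end

section
/- Let M be a positive integer, let 0 ≤ ρ < 1/2, let ε > 0, and let x_u, x_v ∈ [−1, 1] satisfy x_u − x_v > ε. Define P_u = ((1 − 2ρ)/π)·arccos(x_u) + ρ and P_v = ((1 − 2ρ)/π)·arccos(x_v) + ρ, and let H_u and H_v be independent random variables with H_u ∼ Binomial(M, P_u) and H_v ∼ Binomial(M, P_v). Then P(H_u < H_v) ≥ 1 + 1/(4M) − π²/(4M(1 − 2ρ)² ε²). -/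
open MeasureTheory ProbabilityTheory

/-- The binomial distribution with `M` trials and success probability `p`,
as a measure on `ℕ`: `Binomial(M, p) {k} = C(M,k) pᵏ (1-p)^(M-k)` for `0 ≤ k ≤ M`. -/
noncomputable def binomialMeasure (M : ℕ) (p : ℝ) : Measure ℕ :=
  Measure.sum fun k : Fin (M + 1) =>
    ENNReal.ofReal ((M.choose k) * p ^ (k : ℕ) * (1 - p) ^ (M - (k : ℕ))) •
      Measure.dirac (k : ℕ)

/-- The translation operator `f ↦ f (· + c)` on functions on `ℤ`. -/
def intTranslate (c : ℤ) : Module.End ℝ (ℤ → ℝ) where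
  toFun f k := f (k + c)
  map_add' _ _ := rfl
  map_smul' _ _ := rfl

/-- Markov operator of a Bernoulli step of size `c` taken with probability `p`. -/
noncomputable def bernoulliStep (c : ℤ) (p : ℝ) : Module.End ℝ (ℤ → ℝ) :=
  p • intTranslate c + (1 - p) • 1

/-- Markov operator of the walk whose steps are differences of independent
Bernoulli(`q`) and Bernoulli(`p`) variables. -/
noncomputable def walkStep (p q : ℝ) : Module.End ℝ (ℤ → ℝ) :=
  bernoulliStep (-1) p * bernoulliStep 1 q

/-- Expectation of `f` at time `n` for the walk started at `0`. -/
noncomputable def walkMean (p q : ℝ) (n : ℕ) (f : ℤ → ℝ) : ℝ := (walkStep p q ^ n) f 0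

theorem intTranslate_pow_apply (c : ℤ) (n : ℕ) (f : ℤ → ℝ) (k : ℤ) :
    (intTranslate c ^ n) f k = f (k + c * n) := by
  induction n generalizing f k with
  | zero => simp
  | succ n ih =>
    rw [pow_succ, Module.End.mul_apply, ih]
    simp only [intTranslate, LinearMap.coe_mk, AddHom.coe_mk]
    congr 1
    push_cast
    ring

theorem bernoulliStep_pow_apply (c : ℤ) (p : ℝ) (n : ℕ) (f : ℤ → ℝ) (k : ℤ) :
    (bernoulliStep c p ^ n) f k =
      ∑ m ∈ Finset.range (n + 1), n.choose m * p ^ m * (1 - p) ^ (n - m) * f (k + c * m) := by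
  have hc : Commute (p • intTranslate c) ((1 - p) • (1 : Module.End ℝ (ℤ → ℝ))) :=
    ((Commute.one_right _).smul_right _)
  rw [bernoulliStep, hc.add_pow]
  simp only [LinearMap.sum_apply, Finset.sum_apply]
  refine Finset.sum_congr rfl fun m _ => ?_
  rw [(Nat.cast_commute (n.choose m) _).symm.eq]
  simp only [smul_pow, one_pow, Module.End.mul_apply, LinearMap.smul_apply, Module.End.one_apply,
    map_smul, Module.End.natCast_apply, Pi.smul_apply, intTranslate_pow_apply, smul_eq_mul,
    nsmul_eq_mul, Pi.mul_apply, Pi.natCast_apply]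
  ring

theorem walkStep_apply (p q : ℝ) (f : ℤ → ℝ) (k : ℤ) :
    walkStep p q f k = ((1 - p) * (1 - q) + p * q) * f k + q * (1 - p) * f (k + 1)
      + p * (1 - q) * f (k - 1) := by
  simp [walkStep, bernoulliStep, intTranslate, sub_eq_add_neg]
  ring

theorem commute_bernoulliStep (c c' : ℤ) (p q : ℝ) :
    Commute (bernoulliStep c p) (bernoulliStep c' q) := by
  refine LinearMap.ext fun f => funext fun k => ?_
  simp [bernoulliStep, intTranslate, add_right_comm k c c']
  ring

theorem walkMean_eq_sum (p q : ℝ) (n : ℕ) (f : ℤ → ℝ) :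
    walkMean p q n f = ∑ i ∈ Finset.range (n + 1), n.choose i * p ^ i * (1 - p) ^ (n - i) *
      ∑ j ∈ Finset.range (n + 1), n.choose j * q ^ j * (1 - q) ^ (n - j) * f (j - i) := by
  rw [walkMean, walkStep, (commute_bernoulliStep _ _ _ _).mul_pow, Module.End.mul_apply,
    bernoulliStep_pow_apply]
  simp only [bernoulliStep_pow_apply]
  refine Finset.sum_congr rfl fun i _ => ?_
  congr 1
  refine Finset.sum_congr rfl fun j _ => ?_
  congr 2
  ring

@[simp] theorem walkMean_zero (p q : ℝ) (f : ℤ → ℝ) : walkMean p q 0 f = f 0 := by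
  simp [walkMean]

theorem walkMean_succ (p q : ℝ) (n : ℕ) (f : ℤ → ℝ) :
    walkMean p q (n + 1) f = walkMean p q n (walkStep p q f) := by
  rw [walkMean, pow_succ, Module.End.mul_apply, walkMean]

theorem walkMean_add (p q : ℝ) (n : ℕ) (f g : ℤ → ℝ) :
    walkMean p q n (f + g) = walkMean p q n f + walkMean p q n g := by
  simp [walkMean]

theorem walkMean_sub (p q : ℝ) (n : ℕ) (f g : ℤ → ℝ) :
    walkMean p q n (f - g) = walkMean p q n f - walkMean p q n g := by
  simp [walkMean]

theorem walkMean_smul (p q : ℝ) (n : ℕ) (a : ℝ) (f : ℤ → ℝ) :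
    walkMean p q n (a • f) = a * walkMean p q n f := by
  simp [walkMean]

theorem walkMean_nonneg {p q : ℝ} (hp0 : 0 ≤ p) (hp1 : p ≤ 1) (hq0 : 0 ≤ q) (hq1 : q ≤ 1)
    (n : ℕ) {f : ℤ → ℝ} (hf : ∀ k, 0 ≤ f k) : 0 ≤ walkMean p q n f := by
  have := sub_nonneg.2 hp1
  have := sub_nonneg.2 hq1
  rw [walkMean_eq_sum]
  exact Finset.sum_nonneg fun i _ => mul_nonneg (by positivity)
    (Finset.sum_nonneg fun j _ => mul_nonneg (by positivity) (hf _))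

/-- Probability that the walk is at `k` at time `n`. -/
noncomputable def walkProb (p q : ℝ) (n : ℕ) (k : ℤ) : ℝ := walkMean p q n (Pi.single k 1)

theorem walkProb_succ (p q : ℝ) (n : ℕ) (k : ℤ) :
    walkProb p q (n + 1) k = ((1 - p) * (1 - q) + p * q) * walkProb p q n k
      + q * (1 - p) * walkProb p q n (k - 1) + p * (1 - q) * walkProb p q n (k + 1) := by
  simp only [walkProb, walkMean_succ, ← walkMean_smul, ← walkMean_add]
  congr 1
  funext l
  have h1 : l + 1 = k ↔ l = k - 1 := by omega
  have h2 : l - 1 = k ↔ l = k + 1 := by omega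
  simp [walkStep_apply, Pi.single_apply, h1, h2]

/-- Probability that the walk is nonpositive at time `n`. -/
noncomputable def walkTail (p q : ℝ) (n : ℕ) : ℝ :=
  walkMean p q n (fun k => if k ≤ 0 then 1 else 0)

theorem walkTail_sub_succ (p q : ℝ) (n : ℕ) :
    walkTail p q n - walkTail p q (n + 1) =
      q * (1 - p) * walkProb p q n 0 - p * (1 - q) * walkProb p q n 1 := by
  simp only [walkProb, walkTail, walkMean_succ, ← walkMean_smul, ← walkMean_sub]
  congr 1
  funext l
  simp only [Pi.sub_apply, walkStep_apply, Pi.smul_apply, Pi.single_apply, smul_eq_mul]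
  rcases lt_trichotomy l 0 with h | rfl | h
  · rw [if_pos (by omega), if_pos (by omega), if_pos (by omega), if_neg (by omega),
      if_neg (by omega)]
    ring
  · norm_num
    ring
  · rcases eq_or_ne l 1 with rfl | h1
    · norm_num
    · rw [if_neg (by omega), if_neg (by omega), if_neg (by omega), if_neg (by omega),
        if_neg (by omega)]
      ring

/-- Spectral integrals on the critical circle. -/
noncomputable def cosMoment (a b : ℝ) (n k : ℕ) : ℝ :=
  Real.pi⁻¹ * ∫ θ in (0)..Real.pi, (a + 2 * b * Real.cos θ) ^ n * Real.cos (k * θ)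

theorem cosMoment_zero (a b : ℝ) (k : ℕ) : cosMoment a b 0 k = if k = 0 then 1 else 0 := by
  rcases eq_or_ne k 0 with rfl | hk
  · simp [cosMoment, Real.pi_ne_zero]
  · have hk' : (k : ℝ) ≠ 0 := by exact_mod_cast hk
    simp [cosMoment, hk, intervalIntegral.integral_comp_mul_left (fun x => Real.cos x) hk',
      Real.sin_nat_mul_pi]

theorem cosMoment_succ_zero (a b : ℝ) (n : ℕ) :
    cosMoment a b (n + 1) 0 = a * cosMoment a b n 0 + 2 * b * cosMoment a b n 1 := by
  simp only [cosMoment]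
  rw [mul_left_comm a, mul_left_comm (2 * b), ← mul_add]
  congr 1
  rw [← intervalIntegral.integral_const_mul,
    ← intervalIntegral.integral_const_mul, ← intervalIntegral.integral_add]
  · congr 1
    funext θ
    simp
    ring
  all_goals exact Continuous.intervalIntegrable (by fun_prop) _ _

theorem cosMoment_succ_succ (a b : ℝ) (n k : ℕ) :
    cosMoment a b (n + 1) (k + 1) = a * cosMoment a b n (k + 1)
      + b * cosMoment a b n k + b * cosMoment a b n (k + 2) := by
  simp only [cosMoment]
  rw [mul_left_comm a, mul_left_comm b, mul_left_comm b, ← mul_add, ← mul_add]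
  congr 1
  rw [← intervalIntegral.integral_const_mul,
    ← intervalIntegral.integral_const_mul, ← intervalIntegral.integral_const_mul,
    ← intervalIntegral.integral_add, ← intervalIntegral.integral_add]
  · congr 1
    funext θ
    have h1 : ((k : ℕ) : ℝ) * θ = ((k + 1 : ℕ) : ℝ) * θ - θ := by push_cast; ring
    have h2 : ((k + 2 : ℕ) : ℝ) * θ = ((k + 1 : ℕ) : ℝ) * θ + θ := by push_cast; ring
    rw [h1, h2, Real.cos_add, Real.cos_sub]
    ring
  all_goals exact Continuous.intervalIntegrable (by fun_prop) _ _

/-- Fourier representation of the law of the walk; `r ^ 2` is the ratio of the probabilities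
of a down-step and an up-step. -/
theorem walkProb_eq_cosMoment {p q r : ℝ} (hr : p * (1 - q) = q * (1 - p) * r ^ 2) (n k : ℕ) :
    walkProb p q n (-k) =
        r ^ k * cosMoment ((1 - p) * (1 - q) + p * q) (q * (1 - p) * r) n k ∧
      r ^ k * walkProb p q n k =
        cosMoment ((1 - p) * (1 - q) + p * q) (q * (1 - p) * r) n k := by
  induction n generalizing k with
  | zero =>
    rw [cosMoment_zero]
    rcases eq_or_ne k 0 with rfl | hk
    · simp [walkProb]
    · have hk' : (k : ℤ) ≠ 0 := by exact_mod_cast hk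
      simp [walkProb, hk, eq_comm]
  | succ n ih =>
    rcases k with _ | k
    · have h0 := (ih 0).1
      have h1 := ih 1
      simp only [Nat.cast_zero, Nat.cast_one, pow_zero, pow_one, one_mul, neg_zero] at h0 h1 ⊢
      rw [and_self, walkProb_succ, cosMoment_succ_zero, zero_sub, zero_add, h0, h1.1, hr]
      linear_combination q * (1 - p) * r * h1.2
    · obtain ⟨a0, b0⟩ := ih k
      obtain ⟨a1, b1⟩ := ih (k + 1)
      obtain ⟨a2, b2⟩ := ih (k + 2)
      rw [walkProb_succ, walkProb_succ, cosMoment_succ_succ]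
      have e1 : -((k + 1 : ℕ) : ℤ) - 1 = -((k + 2 : ℕ) : ℤ) := by push_cast; ring
      have e2 : -((k + 1 : ℕ) : ℤ) + 1 = -(k : ℤ) := by push_cast; ring
      have e3 : ((k + 1 : ℕ) : ℤ) - 1 = k := by push_cast; ring
      have e4 : ((k + 1 : ℕ) : ℤ) + 1 = ((k + 2 : ℕ) : ℤ) := by push_cast; ring
      rw [e1, e2, e3, e4, a0, a1, a2, hr, ← b0, ← b1, ← b2]
      constructor <;> ring

theorem walkTail_sub_succ_eq_integral {p q r : ℝ} (hr : p * (1 - q) = q * (1 - p) * r ^ 2)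
    (n : ℕ) : walkTail p q n - walkTail p q (n + 1) =
      Real.pi⁻¹ * ∫ θ in (0)..Real.pi,
        ((1 - p) * (1 - q) + p * q + 2 * (q * (1 - p) * r) * Real.cos θ) ^ n *
          (q * (1 - p) * (1 - r * Real.cos θ)) := by
  have h0 := (walkProb_eq_cosMoment hr n 0).2
  have h1 := (walkProb_eq_cosMoment hr n 1).2
  simp only [Nat.cast_zero, Nat.cast_one, pow_zero, pow_one, one_mul] at h0 h1
  have h2 : q * (1 - p) * r ^ 2 * walkProb p q n 1 = q * (1 - p) * r *
      cosMoment ((1 - p) * (1 - q) + p * q) (q * (1 - p) * r) n 1 := by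
    rw [← h1]; ring
  rw [walkTail_sub_succ, h0, hr, h2, cosMoment, cosMoment, mul_left_comm, mul_left_comm _ Real.pi⁻¹,
    ← mul_sub, ← intervalIntegral.integral_const_mul, ← intervalIntegral.integral_const_mul,
    ← intervalIntegral.integral_sub]
  · congr 2
    funext θ
    simp
    ring
  all_goals exact Continuous.intervalIntegrable (by fun_prop) _ _

/-- The sequence of tail probabilities is convex. -/
theorem antitone_walkTail_sub_succ {p q : ℝ} (hp0 : 0 ≤ p) (hq1 : q ≤ 1) (hpq : p < q) :
    Antitone fun n => walkTail p q n - walkTail p q (n + 1) := by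
  have hup : 0 < q * (1 - p) := mul_pos (by linarith) (by linarith)
  have hdn : 0 ≤ p * (1 - q) := mul_nonneg hp0 (by linarith)
  have hpp : 0 ≤ p * q := mul_nonneg hp0 (by linarith)
  have hmm : 0 ≤ (1 - p) * (1 - q) := mul_nonneg (by linarith) (by linarith)
  obtain ⟨r, hr0, hr⟩ : ∃ r, 0 ≤ r ∧ p * (1 - q) = q * (1 - p) * r ^ 2 := by
    refine ⟨√(p * (1 - q) / (q * (1 - p))), Real.sqrt_nonneg _, ?_⟩
    rw [Real.sq_sqrt (by positivity), mul_div_cancel₀ _ hup.ne']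
  have hr1 : r ≤ 1 := by
    by_contra! h
    nlinarith [mul_pos hup (show 0 < r ^ 2 - 1 by nlinarith)]
  have hlow : 2 * (q * (1 - p) * r) ≤ (1 - p) * (1 - q) + p * q := by
    refine abs_le_of_sq_le_sq' ?_ (by linarith) |>.2
    nlinarith [sq_nonneg ((1 - p) * (1 - q) - p * q)]
  have hhigh : (1 - p) * (1 - q) + p * q + 2 * (q * (1 - p) * r) ≤ 1 := by
    nlinarith [mul_nonneg hup.le (sq_nonneg (1 - r))]
  have hb : 0 ≤ q * (1 - p) * r := by positivity
  refine antitone_nat_of_succ_le fun n => ?_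
  rw [walkTail_sub_succ_eq_integral hr, walkTail_sub_succ_eq_integral hr]
  refine mul_le_mul_of_nonneg_left ?_ (by positivity)
  refine intervalIntegral.integral_mono_on Real.pi_pos.le
    (Continuous.intervalIntegrable (by fun_prop) _ _)
    (Continuous.intervalIntegrable (by fun_prop) _ _) fun θ _ => ?_
  have hc := Real.cos_le_one θ
  have hc' := Real.neg_one_le_cos θ
  refine mul_le_mul_of_nonneg_right (pow_le_pow_of_le_one ?_ ?_ n.le_succ) ?_
  · nlinarith
  · nlinarith
  · exact mul_nonneg hup.le (by nlinarith)

/-- Expected total time spent on the nonpositive half-line, bounded by a potential function. -/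
theorem sum_walkTail_le {p q : ℝ} (hp0 : 0 ≤ p) (hq1 : q ≤ 1) (hpq : p < q) (n : ℕ) :
    ∑ j ∈ Finset.range n, walkTail p q j ≤ q * (1 - p) / (q - p) ^ 2 := by
  have hd : 0 < q - p := by linarith
  have hup : 0 < q * (1 - p) := mul_pos (by linarith) (by linarith)
  have hdn : 0 ≤ p * (1 - q) := mul_nonneg hp0 (by linarith)
  obtain ⟨r, hr0, hr⟩ : ∃ r, 0 ≤ r ∧ p * (1 - q) = q * (1 - p) * r := by
    refine ⟨p * (1 - q) / (q * (1 - p)), by positivity, ?_⟩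
    rw [mul_div_cancel₀ _ hup.ne']
  set C := q * (1 - p) / (q - p) ^ 2 with hC
  have hCd : C * (q - p) ^ 2 = q * (1 - p) := by rw [hC]; field_simp
  have hC0 : 0 ≤ C := by positivity
  let f : ℤ → ℝ := fun k => if k ≤ 0 then C - k / (q - p) else C * r ^ k.toNat
  have hf : ∀ k, 0 ≤ f k := by
    intro k
    simp only [f]
    split_ifs with h
    · have : (k : ℝ) ≤ 0 := by exact_mod_cast h
      have := div_nonpos_of_nonpos_of_nonneg this hd.le
      linarith
    · positivity
  have hstep : f - walkStep p q f = fun k => if k ≤ 0 then 1 else 0 := by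
    funext k
    rw [Pi.sub_apply, walkStep_apply]
    rcases lt_trichotomy k 0 with h | rfl | h
    · simp only [f]
      rw [if_pos (by omega), if_pos (by omega), if_pos (by omega), if_pos (by omega)]
      push_cast
      field_simp
      ring
    · norm_num [f]
      have : C * (q - p) = 1 + p * (1 - q) / (q - p) := by
        field_simp
        linarith
      rw [div_eq_mul_inv] at this ⊢
      linear_combination this + C * hr
    · obtain ⟨m, rfl⟩ : ∃ m : ℕ, k = m + 1 := ⟨(k - 1).toNat, by omega⟩
      have h0 : f (m + 1 : ℤ) = C * r ^ (m + 1) := by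
        simp only [f]
        rw [if_neg (by omega)]
        norm_cast
      have h1 : f (m + 1 + 1 : ℤ) = C * r ^ (m + 2) := by
        simp only [f]
        rw [if_neg (by omega)]
        norm_cast
      have h2 : f (m + 1 - 1 : ℤ) = C * r ^ m := by
        rcases Nat.eq_zero_or_pos m with rfl | hm
        · simp [f]
        · simp only [f]
          rw [if_neg (by omega), add_sub_cancel_right, Int.toNat_natCast]
      rw [if_neg (by omega), h0, h1, h2]
      linear_combination (C * r ^ (m + 1) - C * r ^ m) * hr
  have key : ∀ j, walkTail p q j = walkMean p q j f - walkMean p q (j + 1) f := by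
    intro j
    rw [walkMean_succ, ← walkMean_sub, hstep, walkTail]
  simp only [key]
  rw [Finset.sum_range_sub', walkMean_zero]
  have := walkMean_nonneg hp0 (by linarith) (by linarith) hq1 n hf
  have h0 : f 0 = C := by simp [f]
  linarith

theorem walkTail_zero (p q : ℝ) : walkTail p q 0 = 1 := by simp [walkTail]

theorem walkTail_one (p q : ℝ) : walkTail p q 1 = 1 - q * (1 - p) := by
  have := walkTail_sub_succ p q 0
  simp [walkTail_zero, walkProb] at this
  linarith

/-- For a convex sequence, the middle value is at most the average of a symmetric window. -/
theorem convex_mul_le_sum {u : ℕ → ℝ} (hu : Antitone fun n => u n - u (n + 1)) (m c : ℕ)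
    (h : m ≤ c) :
    (2 * m + 1) * u c ≤ ∑ j ∈ Finset.Icc (c - m) (c + m), u j := by
  have hsym : ∀ i ≤ c, 2 * u c ≤ u (c - i) + u (c + i) := by
    intro i
    induction i with
    | zero => intro _; simp; linarith
    | succ i ih =>
      intro hi
      have := ih (by omega)
      have hm : u (c + i) - u (c + i + 1) ≤ u (c - (i + 1)) - u (c - (i + 1) + 1) :=
        hu (show c - (i + 1) ≤ c + i by omega)
      rw [show c - (i + 1) + 1 = c - i by omega] at hm
      rw [← add_assoc]
      linarith
  induction m with
  | zero => simp
  | succ m ih =>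
    have hs : Finset.Icc (c - (m + 1)) (c + (m + 1)) =
        insert (c - (m + 1)) (insert (c + (m + 1)) (Finset.Icc (c - m) (c + m))) := by
      ext x
      simp only [Finset.mem_Icc, Finset.mem_insert]
      omega
    rw [hs, Finset.sum_insert, Finset.sum_insert]
    · have := ih (by omega)
      have := hsym (m + 1) h
      push_cast
      linarith
    · simp
    · simp only [Finset.mem_Icc, Finset.mem_insert]
      omega

theorem walkTail_le {p q : ℝ} (hp0 : 0 ≤ p) (hq1 : q ≤ 1) (hpq : p < q) {n : ℕ} (hn : 0 < n) :
    4 * n * walkTail p q n ≤ 1 / (q - p) ^ 2 - 39 / 100 := by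
  have hd : 0 < q - p := by linarith
  have hd1 : q - p ≤ 1 := by linarith
  rw [le_sub_iff_add_le, le_div_iff₀ (by positivity)]
  obtain rfl | hn2 : n = 1 ∨ 2 ≤ n := by omega
  · rw [walkTail_one]
    have h1 : 1 - q * (1 - p) ≤ 1 - (q - p) := by
      nlinarith [mul_nonneg hp0 (sub_nonneg.2 hq1)]
    have h2 := mul_le_mul_of_nonneg_right h1 (sq_nonneg (q - p))
    push_cast
    nlinarith [mul_nonneg (sq_nonneg (3 * (q - p) - 2)) (show 0 ≤ 3 * (q - p) + 1 by linarith)]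
  · have hconv := convex_mul_le_sum (antitone_walkTail_sub_succ hp0 hq1 hpq) (n - 1) n (by omega)
    have hsum := sum_walkTail_le hp0 hq1 hpq (2 * n)
    have hset : Finset.range (2 * n) = insert 0 (Finset.Icc (n - (n - 1)) (n + (n - 1))) := by
      ext x
      simp only [Finset.mem_range, Finset.mem_insert, Finset.mem_Icc]
      omega
    rw [hset, Finset.sum_insert (by simp; omega), walkTail_zero,
      le_div_iff₀ (by positivity)] at hsum
    rw [Nat.cast_sub (by omega), Nat.cast_one] at hconv
    have hn2' : (2 : ℝ) ≤ n := by exact_mod_cast hn2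
    have hT : 0 ≤ walkTail p q n :=
      walkMean_nonneg hp0 (by linarith) (by linarith) hq1 n fun k => by split_ifs <;> norm_num
    have h34 : 3 / 4 * (2 * n) * walkTail p q n ≤ (2 * (n - 1) + 1 : ℝ) * walkTail p q n :=
      mul_le_mul_of_nonneg_right (by linarith) hT
    have hup : q * (1 - p) ≤ (1 + (q - p)) ^ 2 / 4 := by nlinarith [sq_nonneg (q - (1 - p))]
    have := mul_le_mul_of_nonneg_right (h34.trans hconv) (sq_nonneg (q - p))
    nlinarith [sq_nonneg ((q - p) - 2 / 5)]

theorem integral_binomialMeasure (M : ℕ) {p : ℝ} (hp0 : 0 ≤ p) (hp1 : p ≤ 1) (f : ℕ → ℝ) :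
    ∫ k, f k ∂binomialMeasure M p =
      ∑ k ∈ Finset.range (M + 1), M.choose k * p ^ k * (1 - p) ^ (M - k) * f k := by
  have := sub_nonneg.2 hp1
  rw [binomialMeasure, Measure.sum_fintype, integral_finsetSum_measure, Finset.sum_range]
  · refine Finset.sum_congr rfl fun k _ => ?_
    rw [integral_smul_measure, integral_dirac, ENNReal.toReal_ofReal (by positivity), smul_eq_mul]
  · intro k _
    exact (integrable_dirac (by simp)).smul_measure ENNReal.ofReal_ne_top

theorem measureReal_le_eq_walkTail {Ω : Type*} [MeasurableSpace Ω] (μ : Measure Ω)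
    [IsProbabilityMeasure μ] (M : ℕ) {p q : ℝ} (hp0 : 0 ≤ p) (hp1 : p ≤ 1) (hq0 : 0 ≤ q)
    (hq1 : q ≤ 1) (X Y : Ω → ℕ) (hX : Measurable X) (hY : Measurable Y)
    (hlX : Measure.map X μ = binomialMeasure M p) (hlY : Measure.map Y μ = binomialMeasure M q)
    (hind : IndepFun X Y μ) : μ.real {ω | Y ω ≤ X ω} = walkTail p q M := by
  have hprod := (indepFun_iff_map_prod_eq_prod_map_map hX.aemeasurable hY.aemeasurable).1 hind
  have : IsProbabilityMeasure (μ.map X) := Measure.isProbabilityMeasure_map hX.aemeasurable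
  have : IsProbabilityMeasure (μ.map Y) := Measure.isProbabilityMeasure_map hY.aemeasurable
  have hS : MeasurableSet {z : ℕ × ℕ | z.2 ≤ z.1} := MeasurableSet.of_discrete
  have h1 : μ.real {ω | Y ω ≤ X ω} = ((μ.map X).prod (μ.map Y)).real {z | z.2 ≤ z.1} := by
    rw [← hprod, map_measureReal_apply (hX.prodMk hY) hS]
    rfl
  rw [h1, ← integral_indicator_one hS, integral_prod _ ((integrable_const _).indicator hS), hlX,
    hlY, integral_binomialMeasure M hp0 hp1]
  simp only [integral_binomialMeasure M hq0 hq1]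
  rw [walkTail, walkMean_eq_sum]
  simp [Set.indicator_apply]

theorem sq_mul_le_of_lt_sub_of_arccos {x y ε : ℝ} (hε : 0 < ε) (hx : x ∈ Set.Icc (-1 : ℝ) 1)
    (hy : y ∈ Set.Icc (-1 : ℝ) 1) (h : ε < x - y) :
    ε ^ 2 * (1 + (Real.arccos y - Real.arccos x) ^ 2 / 16) ≤
      (Real.arccos y - Real.arccos x) ^ 2 := by
  set δ := Real.arccos y - Real.arccos x with hδ
  have hδ0 : 0 < δ := sub_pos.2 (Real.arccos_lt_arccos hy.1 (by linarith) hx.2)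
  have hδπ : δ ≤ Real.pi := by linarith [Real.arccos_le_pi y, Real.arccos_nonneg x]
  have hsin : 0 ≤ Real.sin (δ / 2) :=
    Real.sin_nonneg_of_nonneg_of_le_pi (by linarith) (by linarith)
  have h1 : x - y ≤ 2 * Real.sin (δ / 2) := by
    have := Real.cos_sub_cos (Real.arccos x) (Real.arccos y)
    rw [Real.cos_arccos hx.1 hx.2, Real.cos_arccos hy.1 hy.2,
      show (Real.arccos x - Real.arccos y) / 2 = -(δ / 2) by rw [hδ]; ring, Real.sin_neg] at this
    nlinarith [Real.sin_le_one ((Real.arccos x + Real.arccos y) / 2)]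
  have h2 : Real.sin (δ / 2) = 2 * Real.sin (δ / 4) * Real.cos (δ / 4) := by
    rw [← Real.sin_two_mul]; ring_nf
  have hcos : 0 ≤ Real.cos (δ / 4) :=
    Real.cos_nonneg_of_mem_Icc ⟨by linarith, by linarith⟩
  have h3 : ε ≤ δ * Real.cos (δ / 4) := by
    have := mul_le_mul_of_nonneg_right (Real.sin_le (show 0 ≤ δ / 4 by linarith)) hcos
    linarith
  have h4 : Real.cos (δ / 4) ^ 2 * (1 + δ ^ 2 / 16) ≤ 1 := by
    have := Real.cos_le_one_div_sqrt_sq_add_one (x := δ / 4) (by linarith) (by linarith)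
    have h5 := pow_le_pow_left₀ hcos this 2
    rw [div_pow, Real.sq_sqrt (by positivity), le_div_iff₀ (by positivity)] at h5
    linarith
  have h5 := pow_le_pow_left₀ hε.le h3 2
  calc ε ^ 2 * (1 + δ ^ 2 / 16) ≤ (δ * Real.cos (δ / 4)) ^ 2 * (1 + δ ^ 2 / 16) := by gcongr
    _ = δ ^ 2 * (Real.cos (δ / 4) ^ 2 * (1 + δ ^ 2 / 16)) := by ring
    _ ≤ δ ^ 2 := mul_le_of_le_one_right (sq_nonneg _) h4

/-- **Lemma 2.**  Let `M ≥ 1`, `0 ≤ ρ < 1/2`, `ε > 0`, and `x_u, x_v ∈ [-1,1]`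
with `x_u - x_v > ε`.  If `H_u ∼ Binomial(M, P_u)` and `H_v ∼ Binomial(M, P_v)`
are independent, where `P_w = ((1-2ρ)/π)·arccos(x_w) + ρ`, then
`ℙ(H_u < H_v) ≥ 1 + 1/(4M) - π²/(4M(1-2ρ)²ε²)`. -/
theorem hamming_comparison_bound
    {Ω : Type*} [MeasurableSpace Ω] (μ : Measure Ω) [IsProbabilityMeasure μ]
    (M : ℕ) (hM : 0 < M) (ρ ε xu xv : ℝ)
    (hρ0 : 0 ≤ ρ) (hρ : ρ < 1 / 2) (hε : 0 < ε)
    (hxu : xu ∈ Set.Icc (-1 : ℝ) 1) (hxv : xv ∈ Set.Icc (-1 : ℝ) 1)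
    (hgap : xu - xv > ε)
    (Hu Hv : Ω → ℕ) (hmu : Measurable Hu) (hmv : Measurable Hv)
    (hlu : Measure.map Hu μ =
      binomialMeasure M ((1 - 2 * ρ) / Real.pi * Real.arccos xu + ρ))
    (hlv : Measure.map Hv μ =
      binomialMeasure M ((1 - 2 * ρ) / Real.pi * Real.arccos xv + ρ))
    (hind : IndepFun Hu Hv μ) :
    ENNReal.ofReal
        (1 + 1 / (4 * M) - Real.pi ^ 2 / (4 * M * (1 - 2 * ρ) ^ 2 * ε ^ 2)) ≤
      μ {ω | Hu ω < Hv ω} := by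
  have hπ := Real.pi_pos
  have hc : 0 < 1 - 2 * ρ := by linarith
  have hrange : ∀ x, 0 ≤ (1 - 2 * ρ) / Real.pi * Real.arccos x + ρ ∧
      (1 - 2 * ρ) / Real.pi * Real.arccos x + ρ ≤ 1 := by
    intro x
    have h0 := Real.arccos_nonneg x
    refine ⟨by positivity, ?_⟩
    have : (1 - 2 * ρ) / Real.pi * Real.arccos x ≤ (1 - 2 * ρ) / Real.pi * Real.pi := by
      gcongr
      exact Real.arccos_le_pi x
    rw [div_mul_cancel₀ _ hπ.ne'] at this
    linarith
  have hδ : 0 < Real.arccos xv - Real.arccos xu :=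
    sub_pos.2 (Real.arccos_lt_arccos hxv.1 (by linarith) hxu.2)
  have hε2 := sq_mul_le_of_lt_sub_of_arccos hε hxu hxv hgap
  set p := (1 - 2 * ρ) / Real.pi * Real.arccos xu + ρ with hp
  set q := (1 - 2 * ρ) / Real.pi * Real.arccos xv + ρ with hq
  set δ := Real.arccos xv - Real.arccos xu with hδdef
  have hd : q - p = (1 - 2 * ρ) / Real.pi * δ := by rw [hp, hq, hδdef]; ring
  have hpq : p < q := by
    have : 0 < (1 - 2 * ρ) / Real.pi * δ := by positivity
    linarith
  have hM' : (0 : ℝ) < M := by exact_mod_cast hM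
  have htail := walkTail_le (hrange xu).1 (hrange xv).2 hpq hM
  have hgain : 1 / (q - p) ^ 2 + 61 / 100 ≤ Real.pi ^ 2 / ((1 - 2 * ρ) ^ 2 * ε ^ 2) := by
    have h1 : 1 / δ ^ 2 + 1 / 16 ≤ 1 / ε ^ 2 := by
      rw [le_div_iff₀ (by positivity)]
      have : (1 / δ ^ 2 + 1 / 16) * ε ^ 2 = ε ^ 2 * (1 + δ ^ 2 / 16) / δ ^ 2 := by
        field_simp
      rw [this, div_le_one (by positivity)]
      exact hε2
    have h2 : 1 ≤ 1 / (1 - 2 * ρ) ^ 2 := by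
      rw [le_div_iff₀ (by positivity)]
      nlinarith
    have h3 : 976 / 100 ≤ Real.pi ^ 2 := by nlinarith [Real.pi_gt_d2]
    calc 1 / (q - p) ^ 2 + 61 / 100
        ≤ 1 / (q - p) ^ 2 + Real.pi ^ 2 * (1 / (1 - 2 * ρ) ^ 2) * (1 / 16) := by nlinarith
      _ = Real.pi ^ 2 * (1 / (1 - 2 * ρ) ^ 2) * (1 / δ ^ 2 + 1 / 16) := by
        rw [hd]
        field_simp
      _ ≤ Real.pi ^ 2 * (1 / (1 - 2 * ρ) ^ 2) * (1 / ε ^ 2) := by gcongr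
      _ = Real.pi ^ 2 / ((1 - 2 * ρ) ^ 2 * ε ^ 2) := by field_simp
  have hmeas := measureReal_le_eq_walkTail μ M (hrange xu).1 (hrange xu).2 (hrange xv).1
    (hrange xv).2 Hu Hv hmu hmv hlu hlv hind
  have hcompl : {ω | Hu ω < Hv ω} = {ω | Hv ω ≤ Hu ω}ᶜ := by
    ext ω
    simp
  refine ENNReal.ofReal_le_of_le_toReal ?_
  change _ ≤ μ.real _
  rw [hcompl, probReal_compl_eq_one_sub (measurableSet_le hmv hmu), hmeas]
  have hrw : 1 + 1 / (4 * (M : ℝ)) - Real.pi ^ 2 / (4 * M * (1 - 2 * ρ) ^ 2 * ε ^ 2) =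
      1 - (Real.pi ^ 2 / ((1 - 2 * ρ) ^ 2 * ε ^ 2) - 1) / (4 * M) := by
    field_simp
    ring
  rw [hrw]
  have : walkTail p q M ≤ (Real.pi ^ 2 / ((1 - 2 * ρ) ^ 2 * ε ^ 2) - 1) / (4 * M) := by
    rw [le_div_iff₀ (by positivity)]
    linarith
  linarith
end

section
/- Let N and M be positive integers, let x ∈ ℝ^N satisfy ‖x‖₂ = 1, let 0 ≤ ρ < 1/2, and fix an index j ∈ {1,…,N}. Let (b_1, φ^1), …, (b_M, φ^M) be i.i.d. pairs, where each φ^i is a standard Gaussian random vector on ℝ^N and each b_i is an independent random sign with P(b_i = −1) = ρ. Set y_i = b_i·sign(xᵀφ^i) and define the Hamming distance H = #{i ∈ {1,…,M} : y_i ≠ sign(φ^i_j)} (equivalently, almost surely, H = #{i : b_i·(xᵀφ^i)·φ^i_j < 0}). Then H follows the binomial distribution Binomial(M, P_j), where P_j = ((1 − 2ρ)/π)·arccos(x_j) + ρ. -/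
open MeasureTheory ProbabilityTheory

open Finset in
theorem measure_pi_card_mem_eq {Ω : Type*} [MeasurableSpace Ω] (μ : Measure Ω)
    [IsProbabilityMeasure μ] {S : Set Ω} (hS : MeasurableSet S) (M k : ℕ) :
    (Measure.pi fun _ : Fin M => μ) {ω | Nat.card {i : Fin M // ω i ∈ S} = k} =
      M.choose k * (μ S ^ k * μ Sᶜ ^ (M - k)) := by
  classical
  have hset : {ω : Fin M → Ω | Nat.card {i : Fin M // ω i ∈ S} = k} =
      ⋃ s ∈ powersetCard k (univ : Finset (Fin M)),
        Set.univ.pi fun i => if i ∈ s then S else Sᶜ := by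
    ext ω
    simp only [Set.mem_ofPred_eq, Set.mem_iUnion, mem_powersetCard_univ, exists_prop, Set.mem_univ_pi]
    constructor
    · intro h
      refine ⟨univ.filter fun i => ω i ∈ S, ?_, fun i => ?_⟩
      · rw [← h, Nat.card_eq_fintype_card, Fintype.card_subtype]
      · by_cases hi : ω i ∈ S <;> simp [hi]
    · rintro ⟨s, hs, h⟩
      rw [Nat.card_eq_fintype_card, Fintype.card_subtype, ← hs]
      congr 1
      ext i
      have := h i
      by_cases hi : i ∈ s <;> simp_all
  rw [hset, measure_biUnion_finset]
  · rw [sum_congr rfl (g := fun _ => μ S ^ k * μ Sᶜ ^ (M - k))]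
    · simp
    · intro s hs
      rw [mem_powersetCard_univ] at hs
      simp only [Measure.pi_pi, apply_ite μ]
      rw [prod_ite]
      have h : #{i | i ∉ s} = M - k := by
        rw [← hs, ← Finset.compl_filter, card_compl, Fintype.card_fin]
        simp
      simp [h, hs]
  · intro s _ t _ hst
    refine Set.disjoint_left.2 fun ω h1 h2 => hst ?_
    ext i
    simp only [Set.mem_univ_pi] at h1 h2
    have h1 := h1 i
    have h2 := h2 i
    by_cases hi : i ∈ s <;> by_cases hj : i ∈ t <;> simp_all
  · intro s _
    refine MeasurableSet.univ_pi fun i => ?_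
    split_ifs
    exacts [hS, hS.compl]

theorem binomialMeasure_singleton (M : ℕ) (p : ℝ) (k : ℕ) :
    binomialMeasure M p {k} = ENNReal.ofReal (M.choose k * p ^ k * (1 - p) ^ (M - k)) := by
  rw [binomialMeasure, Measure.sum_apply _ (measurableSet_singleton k), tsum_fintype]
  simp only [Measure.smul_apply, smul_eq_mul, Measure.dirac_apply' _ (measurableSet_singleton k),
    Set.indicator_apply, Set.mem_singleton_iff, Pi.one_apply, mul_ite, mul_one, mul_zero]
  by_cases hk : k < M + 1
  · rw [Finset.sum_eq_single_of_mem ⟨k, hk⟩ (Finset.mem_univ _)]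
    · simp
    · intro b _ hb
      exact if_neg fun h => hb (Fin.ext h)
  · rw [Nat.choose_eq_zero_of_lt (by omega), Finset.sum_eq_zero]
    · simp
    · intro b _
      exact if_neg (by omega)

theorem measurable_card_mem {Ω : Type*} [MeasurableSpace Ω]
    {S : Set Ω} (hS : MeasurableSet S) (M : ℕ) :
    Measurable fun ω : Fin M → Ω => Nat.card {i : Fin M // ω i ∈ S} := by
  classical
  have h : (fun ω : Fin M → Ω => Nat.card {i : Fin M // ω i ∈ S}) =
      fun ω => ∑ i, S.indicator (fun _ => 1) (ω i) := by
    ext ω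
    simp [Nat.card_eq_fintype_card, Fintype.card_subtype, Set.indicator_apply]
  rw [h]
  exact Finset.measurable_sum _ fun i _ =>
    (measurable_const.indicator hS).comp (measurable_pi_apply i)

theorem map_card_mem_pi_eq_binomialMeasure {Ω : Type*} [MeasurableSpace Ω] (μ : Measure Ω)
    [IsProbabilityMeasure μ] {S : Set Ω} (hS : MeasurableSet S) (M : ℕ) :
    Measure.map (fun ω : Fin M → Ω => Nat.card {i : Fin M // ω i ∈ S})
      (Measure.pi fun _ => μ) = binomialMeasure M (μ.real S) := by
  refine Measure.ext_of_singleton fun k => ?_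
  rw [Measure.map_apply (measurable_card_mem hS M) (measurableSet_singleton k),
    binomialMeasure_singleton]
  have h1 := measure_pi_card_mem_eq μ hS M k
  rw [← probReal_compl_eq_one_sub hS, ENNReal.ofReal_mul (by positivity),
    ENNReal.ofReal_mul (by positivity), ENNReal.ofReal_pow (by positivity),
    ENNReal.ofReal_pow (by positivity), ofReal_measureReal, ofReal_measureReal,
    ENNReal.ofReal_natCast, mul_assoc, ← h1]
  rfl

theorem stdGaussian_prod_eq_withDensity :
    (gaussianReal 0 1).prod (gaussianReal 0 1) =
      (volume : Measure (ℝ × ℝ)).withDensity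
        fun z => ENNReal.ofReal ((2 * Real.pi)⁻¹ * Real.exp (-(z.1 ^ 2 + z.2 ^ 2) / 2)) := by
  rw [gaussianReal_of_var_ne_zero 0 one_ne_zero,
    prod_withDensity (measurable_gaussianPDF 0 1) (measurable_gaussianPDF 0 1),
    ← Measure.volume_eq_prod]
  congr 1
  ext z
  rw [gaussianPDF, gaussianPDF, ← ENNReal.ofReal_mul (gaussianPDFReal_nonneg 0 1 _),
    gaussianPDFReal_def]
  congr 1
  have h : (√(2 * Real.pi))⁻¹ * (√(2 * Real.pi))⁻¹ = (2 * Real.pi)⁻¹ := by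
    rw [← mul_inv, Real.mul_self_sqrt (by positivity)]
  simp only [NNReal.coe_one, mul_one, sub_zero]
  rw [mul_mul_mul_comm, h, ← Real.exp_add]
  ring_nf

theorem stdGaussian_prod_apply_cone_eq_mul {S : Set (ℝ × ℝ)} (hS : MeasurableSet S) {T : Set ℝ}
    (hT : MeasurableSet T)
    (h : ∀ r t : ℝ, 0 < r → ((r * Real.cos t, r * Real.sin t) ∈ S ↔ t ∈ T)) :
    (gaussianReal 0 1).prod (gaussianReal 0 1) S =
      (∫⁻ r in Set.Ioi (0 : ℝ), ENNReal.ofReal r *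
        ENNReal.ofReal ((2 * Real.pi)⁻¹ * Real.exp (-r ^ 2 / 2))) *
      volume (T ∩ Set.Ioo (-Real.pi) Real.pi) := by
  classical
  rw [stdGaussian_prod_eq_withDensity, withDensity_apply _ hS, ← lintegral_indicator hS,
    ← lintegral_comp_polarCoord_symm]
  have hT' : volume (T ∩ Set.Ioo (-Real.pi) Real.pi) =
      ∫⁻ t in Set.Ioo (-Real.pi) Real.pi, T.indicator 1 t := by
    rw [lintegral_indicator_one hT, Measure.restrict_apply hT]
  rw [hT', ← lintegral_prod_mul (by fun_prop) (measurable_one.indicator hT).aemeasurable,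
    Measure.prod_restrict, ← Measure.volume_eq_prod, polarCoord_target]
  refine setLIntegral_congr_fun (measurableSet_Ioi.prod measurableSet_Ioo) fun p hp => ?_
  have hr : (0 : ℝ) < p.1 := hp.1
  have hcs : (p.1 * Real.cos p.2) ^ 2 + (p.1 * Real.sin p.2) ^ 2 = p.1 ^ 2 := by
    linear_combination p.1 ^ 2 * Real.cos_sq_add_sin_sq p.2
  simp only [polarCoord_symm_apply, Set.indicator_apply, h _ _ hr, hcs, smul_eq_mul, Pi.one_apply]
  split_ifs <;> simp

theorem stdGaussian_prod_apply_cone {S : Set (ℝ × ℝ)} (hS : MeasurableSet S) {T : Set ℝ}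
    (hT : MeasurableSet T)
    (h : ∀ r t : ℝ, 0 < r → ((r * Real.cos t, r * Real.sin t) ∈ S ↔ t ∈ T)) :
    ((gaussianReal 0 1).prod (gaussianReal 0 1)).real S =
      volume.real (T ∩ Set.Ioo (-Real.pi) Real.pi) / (2 * Real.pi) := by
  have h1 := congrArg ENNReal.toReal (stdGaussian_prod_apply_cone_eq_mul hS hT h)
  have h2 := congrArg ENNReal.toReal (stdGaussian_prod_apply_cone_eq_mul
    MeasurableSet.univ MeasurableSet.univ (by simp))
  rw [ENNReal.toReal_mul] at h1 h2
  rw [Set.univ_inter, Real.volume_Ioo, measure_univ,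
    ENNReal.toReal_ofReal (by linarith [Real.pi_pos]), ENNReal.toReal_one] at h2
  rw [measureReal_def, h1, ← measureReal_def, eq_div_iff (by positivity)]
  linear_combination -volume.real (T ∩ Set.Ioo (-Real.pi) Real.pi) * h2

theorem volume_cos_mul_cos_sub_neg {θ : ℝ} (h0 : 0 ≤ θ) (hπ : θ ≤ Real.pi) :
    volume.real ({t | Real.cos t * Real.cos (t - θ) < 0} ∩ Set.Ioo (-Real.pi) Real.pi) =
      2 * θ := by
  set T : Set ℝ := {t | Real.cos t * Real.cos (t - θ) < 0} with hT
  have hTm : MeasurableSet T := measurableSet_lt (by fun_prop) measurable_const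
  have hper : Function.Periodic (T.indicator (1 : ℝ → ℝ)) Real.pi := by
    intro t
    have : t + Real.pi ∈ T ↔ t ∈ T := by
      simp only [hT, Set.mem_ofPred_eq, Real.cos_add_pi, add_sub_right_comm, neg_mul_neg]
    simp only [Set.indicator_apply, this, Pi.one_apply]
  have hint (a b : ℝ) (hab : a ≤ b) :
      ∫ t in a..b, T.indicator (1 : ℝ → ℝ) t = volume.real (T ∩ Set.Ioc a b) := by
    rw [intervalIntegral.integral_of_le hab, integral_indicator_one hTm,
      measureReal_restrict_apply hTm]
  have hIoo : T ∩ Set.Ioc (-(Real.pi / 2)) (Real.pi / 2) =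
      Set.Ioo (-(Real.pi / 2)) (θ - Real.pi / 2) := by
    ext t
    simp only [hT, Set.mem_inter_iff, Set.mem_ofPred_eq, Set.mem_Ioc, Set.mem_Ioo]
    constructor
    · rintro ⟨h, h1, h2⟩
      refine ⟨h1, ?_⟩
      by_contra! h3
      exact h.not_ge (mul_nonneg (Real.cos_nonneg_of_mem_Icc ⟨h1.le, h2⟩)
        (Real.cos_nonneg_of_mem_Icc ⟨by linarith, by linarith⟩))
    · rintro ⟨h1, h2⟩
      refine ⟨mul_neg_of_pos_of_neg (Real.cos_pos_of_mem_Ioo ⟨h1, by linarith⟩) ?_, h1,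
        by linarith⟩
      rw [← Real.cos_neg]
      exact Real.cos_neg_of_pi_div_two_lt_of_lt (by linarith) (by linarith)
  have hae : volume.real (T ∩ Set.Ioo (-Real.pi) Real.pi) =
      volume.real (T ∩ Set.Ioc (-Real.pi) Real.pi) :=
    measureReal_congr ((ae_eq_refl T).inter Ioo_ae_eq_Ioc)
  have hpi := Real.pi_pos
  have h2 := hper.intervalIntegral_add_zsmul_eq 2 (-Real.pi)
  rw [hper.intervalIntegral_add_eq (-Real.pi) (-(Real.pi / 2)),
    show -Real.pi + (2 : ℤ) • Real.pi = Real.pi by simp; ring,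
    show -(Real.pi / 2) + Real.pi = Real.pi / 2 by ring, hint _ _ (by linarith),
    hint _ _ (by linarith), hIoo, Real.volume_real_Ioo_of_le (by linarith)] at h2
  have hii (a b : ℝ) : IntervalIntegrable (T.indicator (1 : ℝ → ℝ)) volume a b := by
    rw [intervalIntegrable_iff]
    exact (intervalIntegrable_iff.1 (intervalIntegrable_const (c := (1 : ℝ)))).indicator hTm
  rw [hae, h2 hii]
  simp

theorem stdGaussian_prod_mul_neg {a : ℝ} (h1 : -1 ≤ a) (h2 : a ≤ 1) :
    ((gaussianReal 0 1).prod (gaussianReal 0 1)).real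
      {z | (a * z.1 + √(1 - a ^ 2) * z.2) * z.1 < 0} = Real.arccos a / Real.pi := by
  rw [stdGaussian_prod_apply_cone (T := {t | Real.cos t * Real.cos (t - Real.arccos a) < 0})
    (measurableSet_lt (by fun_prop) measurable_const)
    (measurableSet_lt (by fun_prop) measurable_const),
    volume_cos_mul_cos_sub_neg (Real.arccos_nonneg a) (Real.arccos_le_pi a)]
  · field_simp
  · intro r t hr
    simp only [Set.mem_ofPred_eq, Real.cos_sub, Real.cos_arccos h1 h2, Real.sin_arccos]
    have h : (a * (r * Real.cos t) + √(1 - a ^ 2) * (r * Real.sin t)) * (r * Real.cos t) =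
        r ^ 2 * (Real.cos t * (Real.cos t * a + Real.sin t * √(1 - a ^ 2))) := by ring
    rw [h]
    exact smul_neg_iff_of_pos_left (pow_pos hr 2)

theorem charFunDual_gaussianReal_zero_one (L : StrongDual ℝ ℝ) :
    charFunDual (gaussianReal 0 1) L = Complex.exp (-((L 1 ^ 2 : ℝ) : ℂ) / 2) := by
  have h (v : ℝ) : (L v : ℂ) = (L 1 : ℂ) * v := by
    rw [← Complex.ofReal_mul, Complex.ofReal_inj]
    simpa [mul_comm] using L.map_smul v 1
  have h1 := charFun_gaussianReal (μ := 0) (v := 1) (L 1)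
  rw [charFun_apply_real] at h1
  rw [charFunDual_apply, integral_congr_ae (ae_of_all _ fun v => by rw [h v]), h1]
  congr 1
  push_cast
  ring

theorem map_pi_gaussian_eq_map_prod {ι : Type*} [Fintype ι] (x : ι → ℝ)
    (hx : ∑ i, x i ^ 2 = 1) (j : ι) :
    (Measure.pi fun _ : ι => gaussianReal 0 1).map (fun φ => (φ j, ∑ k, x k * φ k)) =
      ((gaussianReal 0 1).prod (gaussianReal 0 1)).map
        (fun z => (z.1, x j * z.1 + √(1 - x j ^ 2) * z.2)) := by
  classical
  let A : (ι → ℝ) →L[ℝ] ℝ × ℝ :=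
    (ContinuousLinearMap.proj j).prod (∑ k, x k • ContinuousLinearMap.proj k)
  let B : ℝ × ℝ →L[ℝ] ℝ × ℝ :=
    (ContinuousLinearMap.fst ℝ ℝ ℝ).prod
      (x j • ContinuousLinearMap.fst ℝ ℝ ℝ + √(1 - x j ^ 2) • ContinuousLinearMap.snd ℝ ℝ ℝ)
  have hA : (fun φ : ι → ℝ => (φ j, ∑ k, x k * φ k)) = A := by
    ext φ <;> simp [A]
  have hB : (fun z : ℝ × ℝ => (z.1, x j * z.1 + √(1 - x j ^ 2) * z.2)) = B := by
    ext z <;> simp [B]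
  have hxj : x j ^ 2 ≤ 1 := hx ▸
    Finset.single_le_sum (f := fun i => x i ^ 2) (fun i _ => sq_nonneg _) (Finset.mem_univ j)
  rw [hA, hB]
  have := Measure.isProbabilityMeasure_map (μ := Measure.pi fun _ : ι => gaussianReal 0 1)
    A.continuous.aemeasurable
  have := Measure.isProbabilityMeasure_map (μ := (gaussianReal 0 1).prod (gaussianReal 0 1))
    B.continuous.aemeasurable
  refine Measure.ext_of_charFunDual (funext fun L => ?_)
  have hL (u v : ℝ) : L (u, v) = L (1, 0) * u + L (0, 1) * v := by
    have : (u, v) = u • ((1, 0) : ℝ × ℝ) + v • ((0, 1) : ℝ × ℝ) := by simp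
    rw [this, map_add, map_smul, map_smul, smul_eq_mul, smul_eq_mul, mul_comm u, mul_comm v]
  rw [charFunDual_map, charFunDual_map, charFunDual_pi, charFunDual_prod]
  simp only [charFunDual_gaussianReal_zero_one, ← Complex.exp_sum, ← Complex.exp_add]
  congr 1
  rw [← Finset.sum_div, ← add_div]
  congr 1
  norm_cast
  rw [Finset.sum_neg_distrib, ← neg_add]
  congr 1
  have hAL (k : ι) : (L ∘SL A ∘SL ContinuousLinearMap.single ℝ (fun _ => ℝ) k) 1 =
      L (1, 0) * (Pi.single k (1 : ℝ) : ι → ℝ) j + L (0, 1) * x k := by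
    rw [ContinuousLinearMap.comp_apply, ContinuousLinearMap.comp_apply, ← hA, hL]
    simp [Pi.single_apply]
  have hBl : (L ∘SL B ∘SL ContinuousLinearMap.inl ℝ ℝ ℝ) 1 = L (1, 0) + L (0, 1) * x j := by
    rw [ContinuousLinearMap.comp_apply, ContinuousLinearMap.comp_apply, ← hB, hL]
    simp
  have hBr : (L ∘SL B ∘SL ContinuousLinearMap.inr ℝ ℝ ℝ) 1 = L (0, 1) * √(1 - x j ^ 2) := by
    rw [ContinuousLinearMap.comp_apply, ContinuousLinearMap.comp_apply, ← hB, hL]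
    simp
  simp only [ContinuousLinearMap.comp_assoc, hAL, hBl, hBr, mul_pow]
  rw [Real.sq_sqrt (by linarith)]
  have hsum : ∑ k, (L (1, 0) * (Pi.single k (1 : ℝ) : ι → ℝ) j + L (0, 1) * x k) ^ 2 =
      ∑ k, (Pi.single k (L (1, 0) ^ 2 + 2 * L (1, 0) * L (0, 1) * x k) : ι → ℝ) j +
        L (0, 1) ^ 2 * ∑ k, x k ^ 2 := by
    rw [Finset.mul_sum, ← Finset.sum_add_distrib]
    refine Finset.sum_congr rfl fun k _ => ?_
    by_cases hk : j = k
    · subst hk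
      simp
      ring
    · simp [hk, mul_pow]
  rw [hsum, hx, Finset.sum_pi_single j _ _, if_pos (Finset.mem_univ j)]
  ring

theorem pi_gaussian_inner_mul_neg {ι : Type*} [Fintype ι] (x : ι → ℝ)
    (hx : ∑ i, x i ^ 2 = 1) (j : ι) :
    (Measure.pi fun _ : ι => gaussianReal 0 1).real {φ | (∑ k, x k * φ k) * φ j < 0} =
      Real.arccos (x j) / Real.pi := by
  have hxj : x j ^ 2 ≤ 1 := hx ▸
    Finset.single_le_sum (f := fun i => x i ^ 2) (fun i _ => sq_nonneg _) (Finset.mem_univ j)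
  have hS : MeasurableSet {w : ℝ × ℝ | w.2 * w.1 < 0} :=
    measurableSet_lt (by fun_prop) measurable_const
  have h := congrArg (fun ν => ν.real {w : ℝ × ℝ | w.2 * w.1 < 0})
    (map_pi_gaussian_eq_map_prod x hx j)
  rw [map_measureReal_apply (by fun_prop) hS, map_measureReal_apply (by fun_prop) hS] at h
  obtain ⟨h1, h2⟩ := abs_le.1 ((sq_le_one_iff_abs_le_one _).1 hxj)
  rw [← stdGaussian_prod_mul_neg h1 h2]
  exact h

theorem isProbabilityMeasure_signFlipMeasure {ρ : ℝ} (h0 : 0 ≤ ρ) (h1 : ρ ≤ 1) :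
    IsProbabilityMeasure (signFlipMeasure ρ) := by
  constructor
  simp [signFlipMeasure, ← ENNReal.ofReal_add h0 (sub_nonneg.2 h1)]

theorem signFlipMeasure_prod_real_apply {Ω : Type*} [MeasurableSpace Ω] (μ : Measure Ω)
    [IsProbabilityMeasure μ] {ρ : ℝ} (h0 : 0 ≤ ρ) (h1 : ρ ≤ 1) {S : Set (ℝ × Ω)}
    (hS : MeasurableSet S) :
    ((signFlipMeasure ρ).prod μ).real S =
      ρ * μ.real {ω | (-1, ω) ∈ S} + (1 - ρ) * μ.real {ω | (1, ω) ∈ S} := by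
  have hm := measurable_measure_prodMk_left (ν := μ) hS
  rw [measureReal_def, Measure.prod_apply hS, signFlipMeasure, lintegral_add_measure,
    lintegral_smul_measure, lintegral_smul_measure, lintegral_dirac' _ hm, lintegral_dirac' _ hm,
    smul_eq_mul, smul_eq_mul, ENNReal.toReal_add (by finiteness) (by finiteness),
    ENNReal.toReal_mul, ENNReal.toReal_mul, ENNReal.toReal_ofReal h0,
    ENNReal.toReal_ofReal (sub_nonneg.2 h1)]
  rfl

theorem signFlip_prod_gaussian_neg {ι : Type*} [Fintype ι] (x : ι → ℝ)
    (hx : ∑ i, x i ^ 2 = 1) (j : ι) {ρ : ℝ} (h0 : 0 ≤ ρ) (h1 : ρ ≤ 1) :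
    ((signFlipMeasure ρ).prod (Measure.pi fun _ : ι => gaussianReal 0 1)).real
        {w | w.1 * (∑ k, x k * w.2 k) * w.2 j < 0} =
      (1 - 2 * ρ) / Real.pi * Real.arccos (x j) + ρ := by
  rw [signFlipMeasure_prod_real_apply _ h0 h1 (measurableSet_lt (by fun_prop) measurable_const)]
  have hneg := pi_gaussian_inner_mul_neg (fun i => -x i) (by simpa using hx) j
  have hpos := pi_gaussian_inner_mul_neg x hx j
  simp only [neg_mul, Finset.sum_neg_distrib, Real.arccos_neg] at hneg
  simp only [Set.mem_ofPred_eq, one_mul, neg_mul, hneg, hpos]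
  field_simp
  ring

/-- **The Hamming distance is binomial.**
Let `x ∈ ℝ^N` have unit norm, `0 ≤ ρ < 1/2`, and let `(b_i, φ^i)`, `i = 1,…,M`,
be i.i.d. pairs with `φ^i` standard Gaussian on `ℝ^N` and `b_i` an independent
random sign with `ℙ(b_i = -1) = ρ` (jointly, their law is the `M`-fold product
of `signFlipMeasure ρ ⊗ N(0, I_N)`).  With `y_i = b_i·sign(xᵀφ^i)`, the Hamming
distance `H = #{i : y_i ≠ sign(φ^i_j)} = #{i : b_i·(xᵀφ^i)·φ^i_j < 0}` follows
`Binomial(M, P_j)` with `P_j = ((1-2ρ)/π)·arccos(x_j) + ρ`. -/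
theorem hamming_distance_binomial
    (N M : ℕ) (hN : 0 < N) (hM : 0 < M)
    (x : Fin N → ℝ) (hx : ∑ i, x i ^ 2 = 1)
    (ρ : ℝ) (hρ0 : 0 ≤ ρ) (hρ : ρ < 1 / 2) (j : Fin N) :
    Measure.map
        (fun ω : Fin M → ℝ × (Fin N → ℝ) =>
          Nat.card {i : Fin M // (ω i).1 * (∑ k, x k * (ω i).2 k) * (ω i).2 j < 0})
        (Measure.pi fun _ : Fin M =>
          (signFlipMeasure ρ).prod (Measure.pi fun _ : Fin N => gaussianReal 0 1)) =
      binomialMeasure M ((1 - 2 * ρ) / Real.pi * Real.arccos (x j) + ρ) := by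
  have := isProbabilityMeasure_signFlipMeasure hρ0 (by linarith)
  rw [← signFlip_prod_gaussian_neg x hx j hρ0 (by linarith)]
  have hS : MeasurableSet {w : ℝ × (Fin N → ℝ) | w.1 * (∑ k, x k * w.2 k) * w.2 j < 0} :=
    measurableSet_lt (by fun_prop) measurable_const
  exact map_card_mem_pi_eq_binomialMeasure _ hS M
end

section
/- Let N and M be positive integers, let x ∈ ℝ^N satisfy ‖x‖₂ = 1, let 0 ≤ ρ < 1/2, and fix an index j ∈ {1,…,N}. Let (b_1, φ^1), …, (b_M, φ^M) be i.i.d. pairs, where each φ^i is a standard Gaussian random vector on ℝ^N and each b_i is an independent random sign with P(b_i = −1) = ρ. Set y_i = b_i·sign(xᵀφ^i) and define the Hamming distance H = #{i ∈ {1,…,M} : y_i ≠ sign(φ^i_j)} (equivalently, almost surely, H = #{i : b_i·(xᵀφ^i)·φ^i_j < 0}). Then E(H) = M·(((1 − 2ρ)/π)·arccos(x_j) + ρ). -/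
open MeasureTheory ProbabilityTheory

/-- The measure of a cone under the standard Gaussian measure on the plane is proportional to its
opening angle. -/
theorem gaussianReal_prod_cone {S : Set (ℝ × ℝ)} {A : Set ℝ} (hS : MeasurableSet S)
    (hA : MeasurableSet A)
    (hSA : ∀ r > 0, ∀ α, (r * Real.cos α, r * Real.sin α) ∈ S ↔ α ∈ A) :
    ((gaussianReal 0 1).prod (gaussianReal 0 1)) S =
      volume (A ∩ Set.Ioo (-Real.pi) Real.pi) / ENNReal.ofReal (2 * Real.pi) := by
  let K : ENNReal := ∫⁻ r in Set.Ioi (0 : ℝ),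
    ENNReal.ofReal r * ENNReal.ofReal ((2 * Real.pi)⁻¹ * Real.exp (-r ^ 2 / 2))
  have key : ∀ {T : Set (ℝ × ℝ)} {B : Set ℝ}, MeasurableSet T → MeasurableSet B →
      (∀ r > 0, ∀ α, (r * Real.cos α, r * Real.sin α) ∈ T ↔ α ∈ B) →
      ((gaussianReal 0 1).prod (gaussianReal 0 1)) T =
        K * volume (B ∩ Set.Ioo (-Real.pi) Real.pi) := by
    intro T B hT hB hTB
    rw [gaussianReal_of_var_ne_zero 0 one_ne_zero,
      prod_withDensity (by fun_prop) (by fun_prop), withDensity_apply _ hT,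
      ← lintegral_indicator hT, ← Measure.volume_eq_prod, ← lintegral_comp_polarCoord_symm]
    have hcongr : ∀ p ∈ polarCoord.target,
        ENNReal.ofReal p.1 • T.indicator
          (fun z : ℝ × ℝ => gaussianPDF 0 1 z.1 * gaussianPDF 0 1 z.2) (polarCoord.symm p) =
        (ENNReal.ofReal p.1 * ENNReal.ofReal ((2 * Real.pi)⁻¹ * Real.exp (-p.1 ^ 2 / 2))) *
          B.indicator 1 p.2 := by
      rintro ⟨r, α⟩ hp
      have hr : 0 < r := hp.1
      have hmem := hTB r hr α
      have hsq : (Real.sqrt (2 * Real.pi))⁻¹ * (Real.sqrt (2 * Real.pi))⁻¹ = (2 * Real.pi)⁻¹ := by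
        rw [← mul_inv, Real.mul_self_sqrt (by positivity)]
      by_cases h : α ∈ B
      · rw [polarCoord_symm_apply, Set.indicator_of_mem (hmem.2 h), Set.indicator_of_mem h,
          smul_eq_mul, Pi.one_apply, mul_one, gaussianPDF, gaussianPDF,
          ← ENNReal.ofReal_mul (gaussianPDFReal_nonneg _ _ _)]
        congr 2
        simp only [gaussianPDFReal, NNReal.coe_one, mul_one, sub_zero]
        rw [mul_mul_mul_comm, hsq, ← Real.exp_add]
        congr 2
        linear_combination (-r ^ 2 / 2) * Real.cos_sq_add_sin_sq α
      · rw [polarCoord_symm_apply, Set.indicator_of_notMem (fun h' => h (hmem.1 h')),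
          Set.indicator_of_notMem h]
        simp
    rw [setLIntegral_congr_fun polarCoord.open_target.measurableSet hcongr, polarCoord_target,
      Measure.volume_eq_prod, ← Measure.prod_restrict, lintegral_prod_mul
        (f := fun r => ENNReal.ofReal r * ENNReal.ofReal ((2 * Real.pi)⁻¹ * Real.exp (-r ^ 2 / 2)))
        (g := B.indicator 1) (by fun_prop) ((measurable_one.indicator hB).aemeasurable), lintegral_indicator_one hB,
      Measure.restrict_apply hB]
  have hK : K * ENNReal.ofReal (2 * Real.pi) = 1 := by
    have h := key MeasurableSet.univ MeasurableSet.univ (fun _ _ _ => by simp)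
    rw [measure_univ, Set.univ_inter, Real.volume_Ioo] at h
    rw [h]
    congr 2
    ring
  rw [key hS hA hSA, mul_comm, div_eq_mul_inv, ENNReal.eq_inv_of_mul_eq_one_left hK]

/-- The characteristic function of a pair of linear functionals of a standard Gaussian vector. -/
theorem charFunDual_map_pi_gaussianReal {τ : Type*} [Fintype τ] (a b : τ → ℝ)
    (L : StrongDual ℝ (ℝ × ℝ)) :
    charFunDual ((Measure.pi fun _ : τ => gaussianReal 0 1).map
        (fun φ => (∑ i, a i * φ i, ∑ i, b i * φ i))) L =
      Complex.exp (-((L (1, 0) ^ 2 * ∑ i, a i ^ 2 + 2 * L (1, 0) * L (0, 1) * ∑ i, a i * b i +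
        L (0, 1) ^ 2 * ∑ i, b i ^ 2 : ℝ) : ℂ) / 2) := by
  have hL : ∀ p : ℝ × ℝ, L p = L (1, 0) * p.1 + L (0, 1) * p.2 := by
    intro p
    have : p = p.1 • ((1 : ℝ), (0 : ℝ)) + p.2 • ((0 : ℝ), (1 : ℝ)) := by ext <;> simp
    conv_lhs => rw [this, map_add, map_smul, map_smul]
    simp only [smul_eq_mul]
    ring
  rw [charFunDual_apply, integral_map (by fun_prop) (by fun_prop)]
  have hprod : ∀ φ : τ → ℝ,
      Complex.exp ((L (∑ i, a i * φ i, ∑ i, b i * φ i) : ℝ) * Complex.I) =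
      ∏ i, Complex.exp (((L (1, 0) * a i + L (0, 1) * b i : ℝ) : ℂ) * (φ i : ℝ) * Complex.I) := by
    intro φ
    rw [← Complex.exp_sum, hL, ← Finset.sum_mul]
    congr 2
    push_cast
    simp only [Finset.mul_sum, ← Finset.sum_add_distrib]
    exact Finset.sum_congr rfl fun i _ => by ring
  simp_rw [hprod]
  rw [integral_fintype_prod_eq_prod (fun i (y : ℝ) =>
    Complex.exp (((L (1, 0) * a i + L (0, 1) * b i : ℝ) : ℂ) * y * Complex.I))]
  simp_rw [← charFun_apply_real, charFun_gaussianReal]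
  rw [← Complex.exp_sum]
  congr 1
  push_cast
  simp only [Finset.mul_sum, ← Finset.sum_add_distrib, ← Finset.sum_neg_distrib, Finset.sum_div]
  exact Finset.sum_congr rfl fun i _ => by ring

/-- The joint law of two linear functionals of a standard Gaussian vector depends only on the
Gram matrix of their coefficient vectors. -/
theorem map_pi_gaussianReal_eq_of_gram_eq {ι κ : Type*} [Fintype ι] [Fintype κ]
    {v w : ι → ℝ} {v' w' : κ → ℝ} (hvv : ∑ i, v i ^ 2 = ∑ i, v' i ^ 2)
    (hww : ∑ i, w i ^ 2 = ∑ i, w' i ^ 2) (hvw : ∑ i, v i * w i = ∑ i, v' i * w' i) :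
    (Measure.pi fun _ : ι => gaussianReal 0 1).map
        (fun φ => (∑ i, v i * φ i, ∑ i, w i * φ i)) =
      (Measure.pi fun _ : κ => gaussianReal 0 1).map
        (fun φ => (∑ i, v' i * φ i, ∑ i, w' i * φ i)) := by
  have := Measure.isProbabilityMeasure_map (μ := Measure.pi fun _ : ι => gaussianReal 0 1)
    (f := fun φ => (∑ i, v i * φ i, ∑ i, w i * φ i)) (by fun_prop)
  have := Measure.isProbabilityMeasure_map (μ := Measure.pi fun _ : κ => gaussianReal 0 1)
    (f := fun φ => (∑ i, v' i * φ i, ∑ i, w' i * φ i)) (by fun_prop)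
  refine Measure.ext_of_charFunDual (funext fun L => ?_)
  rw [charFunDual_map_pi_gaussianReal, charFunDual_map_pi_gaussianReal, hvv, hww, hvw]

/-- The directions `α` with `cos (2 * α) < -cos θ` form two opposite sectors of total
angle `2 * θ`. -/
theorem volume_sector {θ : ℝ} (h0 : 0 ≤ θ) (hπ : θ ≤ Real.pi) :
    volume ({α | Real.cos (2 * α) < -Real.cos θ} ∩ Set.Ioo (-Real.pi) Real.pi) =
      ENNReal.ofReal (2 * θ) := by
  have hpos : ∀ β, 0 ≤ β → β < Real.pi → (Real.cos (2 * β) < -Real.cos θ ↔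
      (Real.pi - θ) / 2 < β ∧ β < (Real.pi + θ) / 2) := by
    intro β hβ0 hβπ
    rw [← Real.cos_pi_sub]
    rcases le_total (2 * β) Real.pi with h | h
    · rw [Real.strictAntiOn_cos.lt_iff_gt ⟨by linarith, h⟩ ⟨by linarith, by linarith⟩]
      constructor
      · intro h'
        constructor <;> linarith
      · rintro ⟨h', -⟩
        linarith
    · rw [← Real.cos_two_pi_sub (2 * β),
        Real.strictAntiOn_cos.lt_iff_gt ⟨by linarith, by linarith⟩ ⟨by linarith, by linarith⟩]
      constructor
      · intro h'
        constructor <;> linarith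
      · rintro ⟨-, h'⟩
        linarith
  have hset : {α | Real.cos (2 * α) < -Real.cos θ} ∩ Set.Ioo (-Real.pi) Real.pi =
      Set.Ioo (-((Real.pi + θ) / 2)) (-((Real.pi - θ) / 2)) ∪
        Set.Ioo ((Real.pi - θ) / 2) ((Real.pi + θ) / 2) := by
    ext α
    simp only [Set.mem_inter_iff, Set.mem_ofPred_eq, Set.mem_Ioo, Set.mem_union]
    constructor
    · rintro ⟨hc, h1, h2⟩
      rcases le_total 0 α with h | h
      · exact Or.inr ((hpos α h h2).1 hc)
      · have := (hpos (-α) (by linarith) (by linarith)).1 (by rwa [mul_neg, Real.cos_neg])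
        exact Or.inl ⟨by linarith, by linarith⟩
    · rintro (⟨h1, h2⟩ | ⟨h1, h2⟩)
      · have := (hpos (-α) (by linarith) (by linarith)).2 ⟨by linarith, by linarith⟩
        rw [mul_neg, Real.cos_neg] at this
        exact ⟨this, by linarith, by linarith⟩
      · exact ⟨(hpos α (by linarith) (by linarith)).2 ⟨h1, h2⟩, by linarith, by linarith⟩
  rw [hset, measure_union _ measurableSet_Ioo, Real.volume_Ioo, Real.volume_Ioo,
    ← ENNReal.ofReal_add (by linarith) (by linarith)]
  · congr 1
    ring
  · rw [Set.disjoint_left]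
    rintro α ⟨-, h1⟩ ⟨h2, -⟩
    linarith

/-- Sheppard's formula: the probability that `⟨x, φ⟩` and `φ j` have opposite signs. -/
theorem pi_gaussianReal_mul_neg {ι : Type*} [Fintype ι] (x : ι → ℝ) (hx : ∑ i, x i ^ 2 = 1)
    (j : ι) :
    (Measure.pi fun _ : ι => gaussianReal 0 1) {φ | (∑ k, x k * φ k) * φ j < 0} =
      ENNReal.ofReal (Real.arccos (x j) / Real.pi) := by
  classical
  set θ := Real.arccos (x j) with hθ
  have hj : x j ^ 2 ≤ 1 :=
    hx ▸ Finset.single_le_sum (f := fun i => x i ^ 2) (fun i _ => sq_nonneg _) (Finset.mem_univ j)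
  have hcos : Real.cos θ = x j :=
    Real.cos_arccos (by nlinarith) (by nlinarith)
  have hhalf : Real.cos (θ / 2) ^ 2 - Real.sin (θ / 2) ^ 2 = Real.cos θ := by
    rw [← Real.cos_two_mul', mul_div_cancel₀ _ two_ne_zero]
  have hone := Real.cos_sq_add_sin_sq (θ / 2)
  have hmap := map_pi_gaussianReal_eq_of_gram_eq (v := x) (w := Pi.single j 1)
    (v' := ![Real.cos (θ / 2), Real.sin (θ / 2)]) (w' := ![Real.cos (θ / 2), -Real.sin (θ / 2)])
    (by simp [hx, hone]) (by simp [Pi.single_apply, hone])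
    (by simp [Pi.single_apply, ← hcos, ← hhalf]; ring)
  have hneg : MeasurableSet {p : ℝ × ℝ | p.1 * p.2 < 0} :=
    measurableSet_lt (by fun_prop) (by fun_prop)
  let T : Set (ℝ × ℝ) := {p | (Real.cos (θ / 2) * p.1 + Real.sin (θ / 2) * p.2) *
    (Real.cos (θ / 2) * p.1 - Real.sin (θ / 2) * p.2) < 0}
  have hT : MeasurableSet T := measurableSet_lt (by fun_prop) (by fun_prop)
  calc (Measure.pi fun _ : ι => gaussianReal 0 1) {φ | (∑ k, x k * φ k) * φ j < 0}
      = (Measure.pi fun _ : Fin 2 => gaussianReal 0 1)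
          (MeasurableEquiv.finTwoArrow ⁻¹' T) := by
        have h := congrArg (fun μ => μ {p : ℝ × ℝ | p.1 * p.2 < 0}) hmap
        rw [Measure.map_apply (by fun_prop) hneg, Measure.map_apply (by fun_prop) hneg] at h
        convert h using 2
        · ext φ
          simp [Pi.single_apply]
        · ext φ
          simp [T, sub_eq_add_neg]
    _ = ((gaussianReal 0 1).prod (gaussianReal 0 1)) T :=
        (measurePreserving_finTwoArrow (gaussianReal 0 1)).measure_preimage hT.nullMeasurableSet
    _ = ENNReal.ofReal (2 * θ) / ENNReal.ofReal (2 * Real.pi) := by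
        rw [gaussianReal_prod_cone (A := {α | Real.cos (2 * α) < -Real.cos θ}) hT
          (measurableSet_lt (by fun_prop) (by fun_prop)),
          volume_sector (Real.arccos_nonneg _) (Real.arccos_le_pi _)]
        intro r hr α
        have : (Real.cos (θ / 2) * (r * Real.cos α) + Real.sin (θ / 2) * (r * Real.sin α)) *
            (Real.cos (θ / 2) * (r * Real.cos α) - Real.sin (θ / 2) * (r * Real.sin α)) =
            r ^ 2 / 2 * (Real.cos (2 * α) + Real.cos θ) := by
          rw [Real.cos_two_mul', ← hhalf]
          linear_combination (r ^ 2 / 2 * (Real.cos (θ / 2) ^ 2 - Real.sin (θ / 2) ^ 2)) *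
            Real.cos_sq_add_sin_sq α + r ^ 2 / 2 * (Real.cos α ^ 2 - Real.sin α ^ 2) * hone
        simp only [T, Set.mem_ofPred_eq, this]
        rw [← smul_eq_mul, smul_neg_iff_of_pos_left (by positivity), lt_neg_iff_add_neg]
    _ = ENNReal.ofReal (θ / Real.pi) := by
        rw [← ENNReal.ofReal_div_of_pos (by positivity),
          mul_div_mul_left _ _ two_ne_zero]

/-- The probability that a sign measurement, flipped with probability `ρ`, disagrees with the sign
of the `j`-th coordinate. -/
theorem signFlipMeasure_prod_mul_neg {ι : Type*} [Fintype ι] (x : ι → ℝ)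
    (hx : ∑ i, x i ^ 2 = 1) {ρ : ℝ} (h0 : 0 ≤ ρ) (h1 : ρ ≤ 1) (j : ι) :
    ((signFlipMeasure ρ).prod (Measure.pi fun _ : ι => gaussianReal 0 1)).real
        {p | p.1 * (∑ k, x k * p.2 k) * p.2 j < 0} =
      (1 - 2 * ρ) / Real.pi * Real.arccos (x j) + ρ := by
  have hS : MeasurableSet {p : ℝ × (ι → ℝ) | p.1 * (∑ k, x k * p.2 k) * p.2 j < 0} :=
    measurableSet_lt (by fun_prop) (by fun_prop)
  have hminus := pi_gaussianReal_mul_neg (fun i => -x i) (by simpa using hx) j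
  have hplus := pi_gaussianReal_mul_neg x hx j
  simp only [neg_mul, Finset.sum_neg_distrib] at hminus
  have hnonneg : ∀ t, 0 ≤ Real.arccos t / Real.pi := fun t =>
    div_nonneg (Real.arccos_nonneg t) Real.pi_pos.le
  rw [measureReal_def, signFlipMeasure, Measure.add_prod, Measure.prod_smul_left,
    Measure.prod_smul_left, Measure.dirac_prod, Measure.dirac_prod, Measure.add_apply,
    Measure.smul_apply, Measure.smul_apply, Measure.map_apply (by fun_prop) hS,
    Measure.map_apply (by fun_prop) hS]
  simp only [Set.preimage_ofPred_eq, neg_mul, one_mul, hminus, hplus, smul_eq_mul]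
  rw [← ENNReal.ofReal_mul h0, ← ENNReal.ofReal_mul (sub_nonneg.2 h1),
    ← ENNReal.ofReal_add (mul_nonneg h0 (hnonneg _)) (mul_nonneg (sub_nonneg.2 h1) (hnonneg _)),
    ENNReal.toReal_ofReal (add_nonneg (mul_nonneg h0 (hnonneg _))
      (mul_nonneg (sub_nonneg.2 h1) (hnonneg _))), Real.arccos_neg]
  field_simp [Real.pi_ne_zero]
  ring

/-- **Expected Hamming distance.**
Let `x ∈ ℝ^N` have unit norm, `0 ≤ ρ < 1/2`, and let `(b_i, φ^i)`, `i = 1,…,M`,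
be i.i.d. pairs with `φ^i` standard Gaussian on `ℝ^N` and `b_i` an independent
random sign with `ℙ(b_i = -1) = ρ` (jointly, their law is the `M`-fold product
of `signFlipMeasure ρ ⊗ N(0, I_N)`).  With `y_i = b_i·sign(xᵀφ^i)`, the Hamming
distance `H = #{i : y_i ≠ sign(φ^i_j)} = #{i : b_i·(xᵀφ^i)·φ^i_j < 0}` satisfies
`E(H) = M·(((1-2ρ)/π)·arccos(x_j) + ρ)`. -/
theorem hamming_distance_expectation
    (N M : ℕ) (hN : 0 < N) (hM : 0 < M)
    (x : Fin N → ℝ) (hx : ∑ i, x i ^ 2 = 1)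
    (ρ : ℝ) (hρ0 : 0 ≤ ρ) (hρ : ρ < 1 / 2) (j : Fin N) :
    (∫ ω : Fin M → ℝ × (Fin N → ℝ),
        ((Nat.card {i : Fin M //
            (ω i).1 * (∑ k, x k * (ω i).2 k) * (ω i).2 j < 0} : ℕ) : ℝ)
        ∂(Measure.pi fun _ : Fin M =>
          (signFlipMeasure ρ).prod (Measure.pi fun _ : Fin N => gaussianReal 0 1))) =
      M * ((1 - 2 * ρ) / Real.pi * Real.arccos (x j) + ρ) := by
  classical
  have := isProbabilityMeasure_signFlipMeasure hρ0 (by linarith : ρ ≤ 1)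
  set μ := (signFlipMeasure ρ).prod (Measure.pi fun _ : Fin N => gaussianReal 0 1)
  let S : Set (ℝ × (Fin N → ℝ)) := {p | p.1 * (∑ k, x k * p.2 k) * p.2 j < 0}
  have hS : MeasurableSet S := measurableSet_lt (by fun_prop) (by fun_prop)
  have hcard : ∀ ω : Fin M → ℝ × (Fin N → ℝ),
      ((Nat.card {i : Fin M // (ω i).1 * (∑ k, x k * (ω i).2 k) * (ω i).2 j < 0} : ℕ) : ℝ) =
        ∑ i, S.indicator 1 (ω i) := by
    intro ω
    simp [Nat.card_eq_fintype_card, Fintype.card_subtype, Set.indicator_apply, S,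
      Finset.sum_boole]
  have hmp : ∀ i : Fin M, MeasurePreserving (Function.eval i) (Measure.pi fun _ : Fin M => μ) μ :=
    fun i => measurePreserving_eval (fun _ : Fin M => μ) i
  have hind : Integrable (S.indicator (1 : ℝ × (Fin N → ℝ) → ℝ)) μ :=
    (integrable_const (1 : ℝ)).indicator hS
  simp_rw [hcard]
  have hint : ∀ i : Fin M, Integrable (fun ω : Fin M → ℝ × (Fin N → ℝ) =>
      S.indicator (1 : ℝ × (Fin N → ℝ) → ℝ) (ω i)) (Measure.pi fun _ : Fin M => μ) :=
    fun i => (hmp i).integrable_comp_of_integrable hind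
  rw [integral_finsetSum _ fun i _ => hint i]
  have hterm : ∀ i : Fin M, ∫ ω, S.indicator (1 : ℝ × (Fin N → ℝ) → ℝ) (ω i)
      ∂(Measure.pi fun _ : Fin M => μ) = (1 - 2 * ρ) / Real.pi * Real.arccos (x j) + ρ := by
    intro i
    have h := integral_map (hmp i).measurable.aemeasurable
      ((hmp i).map_eq.symm ▸ hind.aestronglyMeasurable)
    rw [(hmp i).map_eq, integral_indicator_one hS] at h
    exact h.symm.trans (signFlipMeasure_prod_mul_neg x hx hρ0 (by linarith) j)
  simp [hterm, mul_add]
end
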